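/- arXiv:1209.1605 — 2 statements merged into one kernel-verified Lean document; each statement's English description precedes it below -/
import Mathlib

section
/- Weighted Sobolev embedding on ℝⁿ: Let n ≥ 1, let s, s′ ∈ ℕ and δ, δ′ ∈ ℝ satisfy s′ < s − n/2 and δ′ < δ + n/2. Then there is a constant C, depending only on n, s, s′, δ, δ′, such that every smooth function u : ℝⁿ → ℝ with ‖u‖_{H_{s,δ}(ℝⁿ)} < ∞ satisfies σ(x)^{δ′+k} ‖Dᵏu(x)‖ ≤ C ‖u‖_{H_{s,δ}(ℝⁿ)} for every integer 0 ≤ k ≤ s′ and every x ∈ ℝⁿ; in particular u together with its first s′ derivatives is bounded with the stated weighted decay. -/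
open MeasureTheory

/-- The weighted Sobolev norm `‖u‖_{H_{s,δ}(ℝⁿ)}`, valued in `ℝ≥0∞`:
`(Σ_{k=0}^{s} ∫ σ(x)^{2(δ+k)} ‖Dᵏu(x)‖² dx)^{1/2}` where `σ(x) = (1+|x|²)^{1/2}`. -/
noncomputable def wSob (n s : ℕ) (δ : ℝ) (u : EuclideanSpace ℝ (Fin n) → ℝ) : ENNReal :=
  (∑ k ∈ Finset.range (s + 1),
    ∫⁻ x : EuclideanSpace ℝ (Fin n),
      ENNReal.ofReal ((1 + ‖x‖ ^ 2) ^ (δ + (k : ℝ)) * ‖iteratedFDeriv ℝ k u x‖ ^ 2)) ^ (1/2 : ℝ)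

theorem Real.hardy_rpow_pointwise {a t p q : ℝ} (ha : 0 < a) (ht0 : 0 ≤ t) (ht1 : t ≤ 1) :
    p ^ 2 ≤ ((a + 1) - (a + 2) * t) * p ^ 2 + 2 * t * (1 - t) * p * q
      + ((a + 2) ^ 2 + 4) / a * (t ^ 2 * (p ^ 2 + q ^ 2)) := by
  have key : 0 ≤ a * (a * p ^ 2 - (a + 2) * t * p ^ 2 + 2 * t * (1 - t) * p * q)
      + ((a + 2) ^ 2 + 4) * (t ^ 2 * (p ^ 2 + q ^ 2)) := by
    have h1 : 0 ≤ ((a / 2 - (a + 2) * t) * p) ^ 2 := sq_nonneg _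
    have h2 : 0 ≤ (a / 2 * p + 2 * ((1 - t) * (t * q))) ^ 2 := sq_nonneg _
    have h3 : (1 - t) ^ 2 * (t * q) ^ 2 ≤ 1 * (t * q) ^ 2 :=
      mul_le_mul_of_nonneg_right (by nlinarith) (sq_nonneg _)
    nlinarith [sq_nonneg (a * p), sq_nonneg (t * p), sq_nonneg ((a + 2) * t * q)]
  have h : ((a + 2) ^ 2 + 4) / a * (t ^ 2 * (p ^ 2 + q ^ 2))
      = (((a + 2) ^ 2 + 4) * (t ^ 2 * (p ^ 2 + q ^ 2))) / a := by ring
  rw [h, ← sub_nonneg]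
  have : ((a + 1) - (a + 2) * t) * p ^ 2 + 2 * t * (1 - t) * p * q
      + (((a + 2) ^ 2 + 4) * (t ^ 2 * (p ^ 2 + q ^ 2))) / a - p ^ 2
      = (a * (a * p ^ 2 - (a + 2) * t * p ^ 2 + 2 * t * (1 - t) * p * q)
      + ((a + 2) ^ 2 + 4) * (t ^ 2 * (p ^ 2 + q ^ 2))) / a := by
    field_simp
    ring
  rw [this]
  positivity

/-- A Hardy type inequality on the unit interval. -/
theorem integral_rpow_mul_sq_le {a : ℝ} (ha : 0 < a) {f f' : ℝ → ℝ}
    (hf : ∀ t, HasDerivAt f (f' t) t) (hf' : Continuous f') :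
    ∫ t in (0 : ℝ)..1, t ^ a * f t ^ 2 ≤
      ((a + 2) ^ 2 + 4) / a * ∫ t in (0 : ℝ)..1, t ^ (a + 2) * (f t ^ 2 + f' t ^ 2) := by
  have hfc : Continuous f := continuous_iff_continuousAt.2 fun t => (hf t).continuousAt
  have hpow : ∀ {b : ℝ}, 0 ≤ b → Continuous fun t : ℝ => t ^ b := fun hb =>
    Real.continuous_rpow_const hb
  have c0 := hpow ha.le
  have c1 := hpow (b := a + 1) (by linarith)
  have c2 := hpow (b := a + 2) (by linarith)
  set F' : ℝ → ℝ := fun t => ((a + 1) * t ^ a * (1 - t) + t ^ (a + 1) * (-1)) * f t ^ 2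
    + t ^ (a + 1) * (1 - t) * (2 * f t * f' t) with hF'
  have hF : ∀ t ∈ Set.uIcc (0 : ℝ) 1,
      HasDerivAt (fun t : ℝ => t ^ (a + 1) * (1 - t) * f t ^ 2) (F' t) t := by
    intro t _
    have h1 : HasDerivAt (fun t : ℝ => t ^ (a + 1)) ((a + 1) * t ^ a) t := by
      simpa using Real.hasDerivAt_rpow_const (x := t) (p := a + 1) (Or.inr (by linarith))
    have h2 : HasDerivAt (fun t : ℝ => 1 - t) (-1) t := by
      simpa using (hasDerivAt_id t).const_sub 1
    have h3 : HasDerivAt (fun t => f t ^ 2) (2 * f t * f' t) t := by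
      simpa using (hf t).fun_pow 2
    exact (h1.mul h2).mul h3
  have hF'c : Continuous F' := by fun_prop
  have hzero : ∫ t in (0 : ℝ)..1, F' t = 0 := by
    rw [intervalIntegral.integral_eq_sub_of_hasDerivAt hF (hF'c.intervalIntegrable _ _)]
    simp [Real.zero_rpow (show a + 1 ≠ 0 by linarith)]
  have hmono : ∫ t in (0 : ℝ)..1, t ^ a * f t ^ 2 ≤ ∫ t in (0 : ℝ)..1,
      (F' t + ((a + 2) ^ 2 + 4) / a * (t ^ (a + 2) * (f t ^ 2 + f' t ^ 2))) := by
    refine intervalIntegral.integral_mono_on zero_le_one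
      (Continuous.intervalIntegrable (by fun_prop) _ _)
      (Continuous.intervalIntegrable (by fun_prop) _ _) fun t ht => ?_
    have e1 : t ^ (a + 1) = t ^ a * t := by
      rw [Real.rpow_add' ht.1 (by linarith), Real.rpow_one]
    have e2 : t ^ (a + 2) = t ^ a * t ^ 2 := by
      rw [Real.rpow_add' ht.1 (by linarith), Real.rpow_two]
    have := mul_le_mul_of_nonneg_left
      (Real.hardy_rpow_pointwise (p := f t) (q := f' t) ha ht.1 ht.2) (Real.rpow_nonneg ht.1 a)
    simp only [hF', e1, e2]
    refine this.trans (le_of_eq ?_)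
    ring
  rw [intervalIntegral.integral_add (hF'c.intervalIntegrable _ _)
    (Continuous.intervalIntegrable (by fun_prop) _ _), hzero, zero_add,
    intervalIntegral.integral_const_mul] at hmono
  exact hmono

theorem sq_le_integral_rpow_half {f f' : ℝ → ℝ}
    (hf : ∀ t, HasDerivAt f (f' t) t) (hf' : Continuous f') :
    f 0 ^ 2 ≤ 4 * ∫ t in (0 : ℝ)..1, t ^ (1 / 2 : ℝ) * (f t ^ 2 + f' t ^ 2) := by
  have hfc : Continuous f := continuous_iff_continuousAt.2 fun t => (hf t).continuousAt
  have c0 : Continuous fun t : ℝ => t ^ (1 / 2 : ℝ) := Real.continuous_rpow_const (by norm_num)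
  have hF : ∀ t ∈ Set.uIcc (0 : ℝ) 1,
      HasDerivAt (fun t : ℝ => (t - 1) * f t) (1 * f t + (t - 1) * f' t) t := fun t _ =>
    ((hasDerivAt_id t).sub_const 1).mul (hf t)
  have hint : ∫ t in (0 : ℝ)..1, (1 * f t + (t - 1) * f' t) = f 0 := by
    rw [intervalIntegral.integral_eq_sub_of_hasDerivAt hF
      (Continuous.intervalIntegrable (by fun_prop) _ _)]
    simp
  have hr : IntervalIntegrable (fun t : ℝ => f 0 ^ 2 / 4 * t ^ (-(1 / 2) : ℝ)) volume 0 1 :=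
    (intervalIntegral.intervalIntegrable_rpow' (by norm_num)).const_mul _
  have hmono : ∫ t in (0 : ℝ)..1, f 0 * (1 * f t + (t - 1) * f' t) ≤ ∫ t in (0 : ℝ)..1,
      (f 0 ^ 2 / 4 * t ^ (-(1 / 2) : ℝ) + 2 * (t ^ (1 / 2 : ℝ) * (f t ^ 2 + f' t ^ 2))) := by
    refine intervalIntegral.integral_mono_on_of_le_Ioo zero_le_one
      (Continuous.intervalIntegrable (by fun_prop) _ _)
      (hr.add (Continuous.intervalIntegrable (by fun_prop) _ _)) fun t ht => ?_
    rw [Real.rpow_neg ht.1.le]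
    set r := t ^ (1 / 2 : ℝ)
    have hr0 : 0 < r := Real.rpow_pos_of_pos ht.1 _
    have h1 : f 0 * f t ≤ f 0 ^ 2 / 8 * r⁻¹ + 2 * (r * f t ^ 2) := by
      have : f 0 ^ 2 / 8 * r⁻¹ + 2 * (r * f t ^ 2) - f 0 * f t
        = (f 0 - 4 * r * f t) ^ 2 / (8 * r) := by field_simp; ring
      rw [← sub_nonneg, this]; positivity
    have h2 : f 0 * ((t - 1) * f' t) ≤ f 0 ^ 2 / 8 * r⁻¹ + 2 * (r * ((t - 1) * f' t) ^ 2) := by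
      have : f 0 ^ 2 / 8 * r⁻¹ + 2 * (r * ((t - 1) * f' t) ^ 2) - f 0 * ((t - 1) * f' t)
        = (f 0 - 4 * r * ((t - 1) * f' t)) ^ 2 / (8 * r) := by field_simp; ring
      rw [← sub_nonneg, this]; positivity
    have h3 : r * ((t - 1) * f' t) ^ 2 ≤ r * f' t ^ 2 := by
      refine mul_le_mul_of_nonneg_left ?_ hr0.le
      rw [mul_pow]
      exact mul_le_of_le_one_left (sq_nonneg _) (by nlinarith [ht.1, ht.2])
    linarith
  rw [intervalIntegral.integral_const_mul, hint, intervalIntegral.integral_add hr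
    (Continuous.intervalIntegrable (by fun_prop) _ _), intervalIntegral.integral_const_mul,
    intervalIntegral.integral_const_mul, integral_rpow (Or.inl (by norm_num))] at hmono
  norm_num at hmono
  linarith

/-- A one-dimensional weighted Sobolev inequality for a sequence of successive derivatives. -/
theorem exists_sq_le_sum_integral_rpow (m : ℕ) :
    ∃ C : ℝ, 0 ≤ C ∧ ∀ h : ℕ → ℝ → ℝ, (∀ j t, HasDerivAt (h j) (h (j + 1) t) t) →
      h 0 0 ^ 2 ≤ C * ∑ j ∈ Finset.range (m + 2),
        ∫ t in (0 : ℝ)..1, t ^ (2 * m + 1 / 2 : ℝ) * h j t ^ 2 := by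
  induction m with
  | zero =>
    refine ⟨4, by norm_num, fun h hh => ?_⟩
    have hc : ∀ j, Continuous (h j) := fun j =>
      continuous_iff_continuousAt.2 fun t => (hh j t).continuousAt
    have c0 : Continuous fun t : ℝ => t ^ (1 / 2 : ℝ) := Real.continuous_rpow_const (by norm_num)
    have := sq_le_integral_rpow_half (hh 0) (hc 1)
    simp_rw [mul_add] at this
    rw [intervalIntegral.integral_add (Continuous.intervalIntegrable (by fun_prop) _ _)
      (Continuous.intervalIntegrable (by fun_prop) _ _)] at this
    simpa [Finset.sum_range_succ] using this
  | succ m ih =>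
    obtain ⟨C, hC, H⟩ := ih
    set a : ℝ := 2 * m + 1 / 2 with ha
    have ha0 : 0 < a := by positivity
    have hac : (2 * ((m + 1 : ℕ) : ℝ) + 1 / 2) = a + 2 := by push_cast; ring
    have c2 : Continuous fun t : ℝ => t ^ (a + 2) := Real.continuous_rpow_const (by linarith)
    set D := ((a + 2) ^ 2 + 4) / a with hD
    have hD0 : 0 ≤ D := by positivity
    refine ⟨C * (D * 2), by positivity, fun h hh => ?_⟩
    have hc : ∀ j, Continuous (h j) := fun j =>
      continuous_iff_continuousAt.2 fun t => (hh j t).continuousAt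
    set I : ℕ → ℝ := fun j => ∫ t in (0 : ℝ)..1, t ^ (a + 2) * h j t ^ 2 with hI
    have hI0 : ∀ j, 0 ≤ I j := fun j => intervalIntegral.integral_nonneg zero_le_one
      fun t ht => mul_nonneg (Real.rpow_nonneg ht.1 _) (sq_nonneg _)
    have step : ∀ j, ∫ t in (0 : ℝ)..1, t ^ a * h j t ^ 2 ≤ D * (I j + I (j + 1)) := by
      intro j
      have := integral_rpow_mul_sq_le ha0 (hh j) (hc (j + 1))
      simp_rw [mul_add (_ ^ (a + 2) : ℝ)] at this
      rwa [intervalIntegral.integral_add (Continuous.intervalIntegrable (by fun_prop) _ _)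
        (Continuous.intervalIntegrable (by fun_prop) _ _)] at this
    rw [hac]
    calc h 0 0 ^ 2 ≤ C * ∑ j ∈ Finset.range (m + 2), ∫ t in (0 : ℝ)..1, t ^ a * h j t ^ 2 :=
          H h hh
      _ ≤ C * ∑ j ∈ Finset.range (m + 2), D * (I j + I (j + 1)) := by
          gcongr with j; exact step j
      _ = C * (D * (∑ j ∈ Finset.range (m + 2), I j + ∑ j ∈ Finset.range (m + 2), I (j + 1))) := by
          rw [← Finset.mul_sum, Finset.sum_add_distrib]
      _ ≤ C * (D * (∑ j ∈ Finset.range (m + 1 + 2), I j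
            + ∑ j ∈ Finset.range (m + 1 + 2), I j)) := by
          gcongr ?_ * (?_ * (?_ + ?_))
          · exact Finset.sum_le_sum_of_subset_of_nonneg
              (Finset.range_mono (by omega)) fun j _ _ => hI0 j
          · rw [Finset.sum_range_succ' I (m + 2)]
            linarith [hI0 0]
      _ = _ := by ring

theorem exists_hasDerivAt_along_line {E : Type*} [NormedAddCommGroup E] [NormedSpace ℝ E]
    {u : E → ℝ} (hu : ContDiff ℝ (⊤ : ℕ∞) u) (k : ℕ) (v : Fin k → E) (x y : E) :
    ∃ h : ℕ → ℝ → ℝ, h 0 0 = iteratedFDeriv ℝ k u x v ∧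
      (∀ j t, HasDerivAt (h j) (h (j + 1) t) t) ∧
      ∀ j t, |h j t| ≤ ‖iteratedFDeriv ℝ (k + j) u (x + t • y)‖ * (‖y‖ ^ j * ∏ i, ‖v i‖) := by
  let w : (j : ℕ) → Fin (k + j) → E := fun j => Nat.rec v (fun j wj => Fin.cons y wj) j
  have hw : ∀ j, w (j + 1) = Fin.cons y (w j) := fun j => rfl
  refine ⟨fun j t => iteratedFDeriv ℝ (k + j) u (x + t • y) (w j), by simp [w], ?_, ?_⟩
  · intro j t
    have h1 : HasDerivAt (fun t : ℝ => x + t • y) y t := by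
      simpa using ((hasDerivAt_id t).smul_const y).const_add x
    have h2 : HasFDerivAt (iteratedFDeriv ℝ (k + j) u)
        (fderiv ℝ (iteratedFDeriv ℝ (k + j) u) (x + t • y)) (x + t • y) :=
      (hu.differentiable_iteratedFDeriv
        (by exact_mod_cast WithTop.coe_lt_coe.2 (ENat.natCast_lt_top _)) _).hasFDerivAt
    have h3 := h2.comp_hasDerivAt t h1
    have h4 := (ContinuousMultilinearMap.apply ℝ (fun _ : Fin (k + j) => E) ℝ
      (w j)).hasFDerivAt.comp_hasDerivAt t h3
    exact h4
  · intro j t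
    have hprod : ∏ i, ‖w j i‖ = ‖y‖ ^ j * ∏ i, ‖v i‖ := by
      induction j with
      | zero => simp [w]
      | succ j ih =>
        have : ∏ i : Fin (k + j + 1), ‖w (j + 1) i‖ = ‖y‖ * ∏ i, ‖w j i‖ := by
          rw [Fin.prod_univ_succ, hw]; simp
        rw [show ∏ i, ‖w (j + 1) i‖ = _ from this, ih, pow_succ]
        ring
    rw [← hprod]
    exact (iteratedFDeriv ℝ (k + j) u (x + t • y)).le_opNorm (w j)

theorem lintegral_comp_add_smul {E : Type*} [NormedAddCommGroup E] [NormedSpace ℝ E]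
    [FiniteDimensional ℝ E] [MeasurableSpace E] [BorelSpace E] (μ : Measure E)
    [μ.IsAddHaarMeasure] {f : E → ENNReal} (hf : Measurable f) (x : E) {t : ℝ} (ht : 0 < t) :
    ∫⁻ y, f (x + t • y) ∂μ =
      ENNReal.ofReal (t ^ (-(Module.finrank ℝ E : ℝ))) * ∫⁻ y, f y ∂μ := by
  have h1 : ∫⁻ y, f (x + t • y) ∂μ = ∫⁻ z, f (x + z) ∂(μ.map (t • ·)) :=
    (lintegral_map (hf.comp (measurable_const_add x)) (measurable_const_smul t)).symm
  rw [h1, Measure.map_addHaar_smul μ ht.ne', lintegral_smul_measure,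
    lintegral_add_left_eq_self f x, Real.rpow_neg ht.le, Real.rpow_natCast,
    abs_of_nonneg (by positivity), smul_eq_mul]

theorem lintegral_lintegral_along_rays_le {E : Type*} [NormedAddCommGroup E] [NormedSpace ℝ E]
    [FiniteDimensional ℝ E] [MeasurableSpace E] [BorelSpace E] (μ : Measure E)
    [μ.IsAddHaarMeasure] {f : E → ENNReal} (hf : Measurable f) (x : E) (s : Set E) (a : ℝ) :
    ∫⁻ y in s, (∫⁻ t in Set.Ioc (0 : ℝ) 1, ENNReal.ofReal (t ^ a) * f (x + t • y)) ∂μ ≤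
      (∫⁻ t in Set.Ioc (0 : ℝ) 1, ENNReal.ofReal (t ^ (a - Module.finrank ℝ E)))
        * ∫⁻ y, f y ∂μ := by
  have hm : Measurable fun p : E × ℝ => ENNReal.ofReal (p.2 ^ a) * f (x + p.2 • p.1) := by
    have h1 : Measurable fun p : E × ℝ => x + p.2 • p.1 :=
      Continuous.measurable (by fun_prop)
    exact (measurable_snd.pow_const a).ennreal_ofReal.mul (hf.comp h1)
  calc _ ≤ ∫⁻ y, (∫⁻ t in Set.Ioc (0 : ℝ) 1, ENNReal.ofReal (t ^ a) * f (x + t • y)) ∂μ :=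
        lintegral_mono' Measure.restrict_le_self le_rfl
    _ = ∫⁻ t in Set.Ioc (0 : ℝ) 1, (∫⁻ y, ENNReal.ofReal (t ^ a) * f (x + t • y) ∂μ) :=
        lintegral_lintegral_swap hm.aemeasurable
    _ = ∫⁻ t in Set.Ioc (0 : ℝ) 1, ENNReal.ofReal (t ^ (a - Module.finrank ℝ E))
          * ∫⁻ y, f y ∂μ := by
        refine setLIntegral_congr_fun measurableSet_Ioc fun t ht => ?_
        have h1 : Measurable fun y : E => f (x + t • y) :=
          hf.comp (Continuous.measurable (by fun_prop))
        rw [lintegral_const_mul _ h1, lintegral_comp_add_smul μ hf x ht.1, ← mul_assoc,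
          ← ENNReal.ofReal_mul (Real.rpow_nonneg ht.1.le a), ← Real.rpow_add ht.1, sub_eq_add_neg]
    _ = _ := lintegral_mul_const _ (measurable_id.pow_const _).ennreal_ofReal

theorem lintegral_Ioc_rpow_lt_top {b : ℝ} (hb : -1 < b) :
    ∫⁻ t in Set.Ioc (0 : ℝ) 1, ENNReal.ofReal (t ^ b) < ⊤ := by
  have h := (intervalIntegral.intervalIntegrable_rpow' (a := 0) (b := 1) hb).1
  exact h.lintegral_lt_top

theorem ofReal_intervalIntegral_eq_lintegral {f : ℝ → ℝ} (hf : Continuous f)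
    (h0 : ∀ t, 0 < t → 0 ≤ f t) :
    ENNReal.ofReal (∫ t in (0 : ℝ)..1, f t) = ∫⁻ t in Set.Ioc (0 : ℝ) 1, ENNReal.ofReal (f t) := by
  rw [intervalIntegral.integral_of_le zero_le_one]
  refine ofReal_integral_eq_lintegral_ofReal (hf.intervalIntegrable 0 1).1 ?_
  exact (ae_restrict_mem measurableSet_Ioc).mono fun t ht => h0 t ht.1

/-- On the ball of radius `√(1 + ‖x‖²) / 2` about `x`, the weight is comparable to its value
at `x`. -/
theorem weight_rpow_le {E : Type*} [NormedAddCommGroup E] {x y : E}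
    (h : ‖y‖ ^ 2 ≤ (1 + ‖x‖ ^ 2) / 4) (p : ℝ) :
    (1 + ‖x‖ ^ 2) ^ p ≤ 4 ^ |p| * (1 + ‖x + y‖ ^ 2) ^ p := by
  have h1 : 1 + ‖x‖ ^ 2 ≤ 4 * (1 + ‖x + y‖ ^ 2) := by
    have : ‖x‖ ≤ ‖x + y‖ + ‖y‖ := by simpa using norm_sub_le (x + y) y
    have : ‖x‖ ^ 2 ≤ (‖x + y‖ + ‖y‖) ^ 2 := by gcongr
    nlinarith [sq_nonneg (‖x + y‖ - ‖y‖), sq_nonneg ‖x + y‖]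
  have h2 : 1 + ‖x + y‖ ^ 2 ≤ 4 * (1 + ‖x‖ ^ 2) := by
    have : ‖x + y‖ ^ 2 ≤ (‖x‖ + ‖y‖) ^ 2 := by gcongr; exact norm_add_le x y
    nlinarith [sq_nonneg (‖x‖ - ‖y‖), sq_nonneg ‖x‖]
  have hx : 0 < 1 + ‖x‖ ^ 2 := by positivity
  have hz : 0 < 1 + ‖x + y‖ ^ 2 := by positivity
  rcases le_total 0 p with hp | hp
  · rw [abs_of_nonneg hp, ← Real.mul_rpow (by norm_num) hz.le]
    exact Real.rpow_le_rpow hx.le h1 hp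
  · have h3 := Real.rpow_le_rpow_of_nonpos hz h2 hp
    rw [Real.mul_rpow (by norm_num) hx.le] at h3
    rw [abs_of_nonpos hp, Real.rpow_neg (by norm_num)]
    have h4 : (0 : ℝ) < 4 ^ p := by positivity
    rw [inv_mul_eq_div, le_div_iff₀ h4]
    linarith

/-- Scale-invariant local Sobolev estimate, tested on vectors `v`, obtained by averaging the
one-dimensional inequality over the rays joining `x` to the points of a ball of radius
comparable to `√(1 + ‖x‖²)`. -/
theorem exists_weighted_sq_apply_le {E : Type*} [NormedAddCommGroup E] [NormedSpace ℝ E]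
    [FiniteDimensional ℝ E] [MeasurableSpace E] [BorelSpace E] (μ : Measure E)
    [μ.IsAddHaarMeasure] {m : ℕ} (hm : Module.finrank ℝ E ≤ 2 * m + 1) (δ : ℝ) (k : ℕ) :
    ∃ C : ℝ, 0 ≤ C ∧ ∀ u : E → ℝ, ContDiff ℝ (⊤ : ℕ∞) u → ∀ (S : ENNReal) (x : E) (v : Fin k → E),
      ∑ j ∈ Finset.range (m + 2), ∫⁻ z, ENNReal.ofReal ((1 + ‖z‖ ^ 2) ^ (δ + ((k + j : ℕ) : ℝ)) *
        ‖iteratedFDeriv ℝ (k + j) u z‖ ^ 2) ∂μ ≤ S →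
      ENNReal.ofReal ((1 + ‖x‖ ^ 2) ^ (δ + k + (Module.finrank ℝ E : ℝ) / 2)
        * (iteratedFDeriv ℝ k u x v) ^ 2) ≤ ENNReal.ofReal (C * (∏ i, ‖v i‖) ^ 2) * S := by
  obtain ⟨C₁, hC₁, H⟩ := exists_sq_le_sum_integral_rpow m
  set d := Module.finrank ℝ E with hd
  set a : ℝ := 2 * m + 1 / 2 with ha
  have ha0 : 0 ≤ a := by positivity
  have hI : ∫⁻ t in Set.Ioc (0 : ℝ) 1, ENNReal.ofReal (t ^ (a - d)) < ⊤ := by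
    refine lintegral_Ioc_rpow_lt_top ?_
    have : (d : ℝ) ≤ 2 * m + 1 := by exact_mod_cast hm
    rw [ha]; linarith
  set I := ∫⁻ t in Set.Ioc (0 : ℝ) 1, ENNReal.ofReal (t ^ (a - d))
  set K : ℝ := 4 ^ (|δ + k| + (m + 1 : ℕ)) with hK
  have hK0 : 0 < K := by positivity
  have hb0 : μ (Metric.ball 0 1) ≠ 0 := (Metric.measure_ball_pos μ _ one_pos).ne'
  have hbt : μ (Metric.ball 0 1) ≠ ⊤ := measure_ball_lt_top.ne
  set b := (μ (Metric.ball (0 : E) 1)).toReal with hb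
  have hb' : μ (Metric.ball (0 : E) 1) = ENNReal.ofReal b := (ENNReal.ofReal_toReal hbt).symm
  have hbpos : 0 < b := ENNReal.toReal_pos hb0 hbt
  have hI' : I = ENNReal.ofReal I.toReal := (ENNReal.ofReal_toReal hI.ne).symm
  refine ⟨C₁ * K * I.toReal * 2 ^ d / b, by positivity, fun u hu S x v hS => ?_⟩
  set X : ℝ := 1 + ‖x‖ ^ 2 with hX
  have hX0 : 0 < X := by positivity
  set P : ℝ := (∏ i, ‖v i‖) ^ 2 with hP
  have hP0 : 0 ≤ P := sq_nonneg _
  set R : ℝ := X ^ (1 / 2 : ℝ) / 2 with hR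
  have hR0 : 0 < R := by positivity
  have hR2 : R ^ 2 = X / 4 := by
    rw [hR, div_pow, ← Real.rpow_natCast, ← Real.rpow_mul hX0.le]
    norm_num
  set W : ℕ → E → ℝ := fun j z => (1 + ‖z‖ ^ 2) ^ (δ + ((k + j : ℕ) : ℝ)) *
        ‖iteratedFDeriv ℝ (k + j) u z‖ ^ 2 with hW
  have hWc : ∀ j, Continuous (W j) := fun j => by
    have h1 : Continuous (iteratedFDeriv ℝ (k + j) u) :=
      hu.continuous_iteratedFDeriv (by exact_mod_cast le_top)
    have h2 : Continuous fun z : E => (1 + ‖z‖ ^ 2) ^ (δ + ((k + j : ℕ) : ℝ)) :=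
      Continuous.rpow_const (by fun_prop) fun z => Or.inl (by positivity)
    exact h2.mul (h1.norm.pow 2)
  set A := iteratedFDeriv ℝ k u x v with hA
  have pointwise : ∀ y ∈ Metric.ball (0 : E) R, ENNReal.ofReal (X ^ (δ + k) * A ^ 2) ≤
      ENNReal.ofReal (C₁ * K * P) * ∑ j ∈ Finset.range (m + 2),
        ∫⁻ t in Set.Ioc (0 : ℝ) 1, ENNReal.ofReal (t ^ a) * ENNReal.ofReal (W j (x + t • y)) := by
    intro y hy
    have hyR : ‖y‖ ≤ R := (mem_ball_zero_iff.1 hy).le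
    obtain ⟨h, h0, hder, hbound⟩ := exists_hasDerivAt_along_line hu k v x y
    have hc : ∀ j, Continuous (h j) := fun j =>
      continuous_iff_continuousAt.2 fun t => (hder j t).continuousAt
    have hca : Continuous fun t : ℝ => t ^ a := Real.continuous_rpow_const ha0
    have hterm : ∀ j ∈ Finset.range (m + 2), ∀ t ∈ Set.Ioc (0 : ℝ) 1,
        X ^ (δ + k) * (t ^ a * h j t ^ 2) ≤ K * P * (t ^ a * W j (x + t • y)) := by
      intro j hj t ht
      have hta : 0 ≤ t ^ a := Real.rpow_nonneg ht.1.le a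
      have hty : ‖t • y‖ ^ 2 ≤ X / 4 := by
        rw [← hR2, norm_smul, Real.norm_of_nonneg ht.1.le]
        refine pow_le_pow_left₀ (mul_nonneg ht.1.le (norm_nonneg y)) ?_ 2
        exact (mul_le_of_le_one_left (norm_nonneg y) ht.2).trans hyR
      have hyj : (‖y‖ ^ j) ^ 2 ≤ X ^ j := by
        rw [← pow_mul, mul_comm, pow_mul]
        gcongr
        calc ‖y‖ ^ 2 ≤ R ^ 2 := by gcongr
          _ ≤ X := by rw [hR2]; linarith
      have hw := weight_rpow_le hty (δ + ((k + j : ℕ) : ℝ))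
      have hK' : (4 : ℝ) ^ |δ + ((k + j : ℕ) : ℝ)| ≤ K := by
        refine Real.rpow_le_rpow_of_exponent_le (by norm_num) ?_
        push_cast
        rw [← add_assoc]
        refine (abs_add_le _ _).trans ?_
        rw [Nat.abs_cast]
        have : (j : ℝ) ≤ (m + 1 : ℕ) := by
          exact_mod_cast Nat.le_of_lt_succ (Finset.mem_range.1 hj)
        push_cast at this
        linarith
      have hsq : h j t ^ 2 ≤ ‖iteratedFDeriv ℝ (k + j) u (x + t • y)‖ ^ 2 * (X ^ j * P) := by
        calc h j t ^ 2 = |h j t| ^ 2 := (sq_abs _).symm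
          _ ≤ (‖iteratedFDeriv ℝ (k + j) u (x + t • y)‖ * (‖y‖ ^ j * ∏ i, ‖v i‖)) ^ 2 := by
              gcongr; exact hbound j t
          _ = ‖iteratedFDeriv ℝ (k + j) u (x + t • y)‖ ^ 2 * ((‖y‖ ^ j) ^ 2 * P) := by
              rw [hP]; ring
          _ ≤ _ := by gcongr
      have hXj : X ^ (δ + k) * X ^ j = X ^ (δ + ((k + j : ℕ) : ℝ)) := by
        rw [← Real.rpow_natCast, ← Real.rpow_add hX0]; push_cast; ring_nf
      calc X ^ (δ + k) * (t ^ a * h j t ^ 2)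
          ≤ X ^ (δ + k) * (t ^ a *
              (‖iteratedFDeriv ℝ (k + j) u (x + t • y)‖ ^ 2 * (X ^ j * P))) := by gcongr
        _ = P * (t ^ a * (X ^ (δ + ((k + j : ℕ) : ℝ)) *
              ‖iteratedFDeriv ℝ (k + j) u (x + t • y)‖ ^ 2)) := by rw [← hXj]; ring
        _ ≤ P * (t ^ a * ((K * (1 + ‖x + t • y‖ ^ 2) ^ (δ + ((k + j : ℕ) : ℝ))) *
              ‖iteratedFDeriv ℝ (k + j) u (x + t • y)‖ ^ 2)) := by
            gcongr
            exact hw.trans (by gcongr)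
        _ = _ := by rw [hW]; ring
    have hnn : ∀ j, 0 ≤ ∫ t in (0 : ℝ)..1, t ^ a * h j t ^ 2 := fun j =>
      intervalIntegral.integral_nonneg zero_le_one
        fun t ht => mul_nonneg (Real.rpow_nonneg ht.1 _) (sq_nonneg _)
    calc ENNReal.ofReal (X ^ (δ + k) * A ^ 2)
        ≤ ENNReal.ofReal (C₁ * ∑ j ∈ Finset.range (m + 2),
            ∫ t in (0 : ℝ)..1, X ^ (δ + k) * (t ^ a * h j t ^ 2)) := by
          refine ENNReal.ofReal_le_ofReal ?_
          simp_rw [intervalIntegral.integral_const_mul]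
          rw [← Finset.mul_sum, mul_left_comm, hA, ← h0]
          gcongr
          exact H h hder
      _ = ENNReal.ofReal C₁ * ∑ j ∈ Finset.range (m + 2),
            ∫⁻ t in Set.Ioc (0 : ℝ) 1, ENNReal.ofReal (X ^ (δ + k) * (t ^ a * h j t ^ 2)) := by
          rw [ENNReal.ofReal_mul hC₁, ENNReal.ofReal_sum_of_nonneg]
          · congr 1
            refine Finset.sum_congr rfl fun j _ => ?_
            refine ofReal_intervalIntegral_eq_lintegral (by fun_prop) fun t ht => ?_
            positivity
          · intro j _
            rw [intervalIntegral.integral_const_mul]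
            exact mul_nonneg (by positivity) (hnn j)
      _ ≤ ENNReal.ofReal C₁ * ∑ j ∈ Finset.range (m + 2), ∫⁻ t in Set.Ioc (0 : ℝ) 1,
            ENNReal.ofReal (K * P) *
              (ENNReal.ofReal (t ^ a) * ENNReal.ofReal (W j (x + t • y))) := by
          refine mul_le_mul_right (Finset.sum_le_sum fun j hj => ?_) _
          refine setLIntegral_mono' measurableSet_Ioc fun t ht => ?_
          rw [← ENNReal.ofReal_mul (Real.rpow_nonneg ht.1.le a),
            ← ENNReal.ofReal_mul (by positivity)]
          exact ENNReal.ofReal_le_ofReal (hterm j hj t ht)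
      _ = _ := by
          simp_rw [lintegral_const_mul' _ _ ENNReal.ofReal_ne_top]
          rw [← Finset.mul_sum, ← mul_assoc, ← ENNReal.ofReal_mul hC₁, mul_assoc C₁]
  have averaged : ENNReal.ofReal (X ^ (δ + k) * A ^ 2) * (ENNReal.ofReal (R ^ d) *
      ENNReal.ofReal b) ≤ ENNReal.ofReal (C₁ * K * P) * (I * S) := by
    rw [← hb', ← Measure.addHaar_ball_of_pos μ (0 : E) hR0, ← setLIntegral_const]
    refine (setLIntegral_mono' measurableSet_ball pointwise).trans ?_
    rw [lintegral_const_mul' _ _ ENNReal.ofReal_ne_top]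
    refine mul_le_mul_right ?_ _
    rw [lintegral_finsetSum]
    · refine le_trans ?_ (mul_le_mul_right hS I)
      rw [Finset.mul_sum]
      exact Finset.sum_le_sum fun j _ => lintegral_lintegral_along_rays_le μ
        (hWc j).measurable.ennreal_ofReal x _ a
    · intro j _
      refine Measurable.lintegral_prod_right' (ν := volume.restrict (Set.Ioc (0 : ℝ) 1))
        (f := fun p : E × ℝ =>
        ENNReal.ofReal (p.2 ^ a) * ENNReal.ofReal (W j (x + p.2 • p.1))) ?_
      have h1 : Continuous fun p : E × ℝ => W j (x + p.2 • p.1) :=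
        (hWc j).comp (by fun_prop)
      exact (measurable_snd.pow_const a).ennreal_ofReal.mul h1.measurable.ennreal_ofReal
  have hRd : R ^ d = X ^ ((d : ℝ) / 2) / 2 ^ d := by
    rw [hR, div_pow, ← Real.rpow_natCast, ← Real.rpow_mul hX0.le]
    ring_nf
  have hlhs : X ^ (δ + k + (d : ℝ) / 2) * A ^ 2
      = X ^ (δ + k) * A ^ 2 * (R ^ d * b) * (2 ^ d / b) := by
    rw [Real.rpow_add hX0, hRd]; field_simp
  rw [hlhs, ENNReal.ofReal_mul (by positivity), ENNReal.ofReal_mul (by positivity),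
    ENNReal.ofReal_mul (p := R ^ d) (by positivity)]
  refine (mul_le_mul_left averaged _).trans (le_of_eq ?_)
  rw [show C₁ * K * I.toReal * 2 ^ d / b * P = C₁ * K * P * (I.toReal * (2 ^ d / b)) by ring,
    ENNReal.ofReal_mul (p := C₁ * K * P) (by positivity), ENNReal.ofReal_mul (p := I.toReal)
    (by positivity), ← hI']
  ring

theorem exists_weighted_norm_iteratedFDeriv_le {E : Type*} [NormedAddCommGroup E]
    [NormedSpace ℝ E] [FiniteDimensional ℝ E] [MeasurableSpace E] [BorelSpace E] (μ : Measure E)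
    [μ.IsAddHaarMeasure] {m : ℕ} (hm : Module.finrank ℝ E ≤ 2 * m + 1) (δ : ℝ) (k : ℕ) :
    ∃ C : ℝ, 0 ≤ C ∧ ∀ u : E → ℝ, ContDiff ℝ (⊤ : ℕ∞) u → ∀ (q : ℝ) (x : E), 0 ≤ q →
      ∑ j ∈ Finset.range (m + 2), ∫⁻ z, ENNReal.ofReal ((1 + ‖z‖ ^ 2) ^ (δ + ((k + j : ℕ) : ℝ)) *
        ‖iteratedFDeriv ℝ (k + j) u z‖ ^ 2) ∂μ ≤ ENNReal.ofReal (q ^ 2) →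
      (1 + ‖x‖ ^ 2) ^ ((δ + (Module.finrank ℝ E : ℝ) / 2 + k) / 2) * ‖iteratedFDeriv ℝ k u x‖
        ≤ C * q := by
  obtain ⟨C, hC, H⟩ := exists_weighted_sq_apply_le μ hm δ k
  refine ⟨√C, Real.sqrt_nonneg C, fun u hu q x hq hS => ?_⟩
  have hX0 : 0 < 1 + ‖x‖ ^ 2 := by positivity
  set w := (1 + ‖x‖ ^ 2) ^ ((δ + (Module.finrank ℝ E : ℝ) / 2 + k) / 2) with hw
  have hw0 : 0 < w := Real.rpow_pos_of_pos hX0 _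
  have hw2 : (1 + ‖x‖ ^ 2) ^ (δ + k + (Module.finrank ℝ E : ℝ) / 2) = w ^ 2 := by
    rw [hw, ← Real.rpow_mul_natCast hX0.le]
    congr 1
    push_cast
    ring
  rw [mul_comm, ← le_div_iff₀ hw0]
  refine ContinuousMultilinearMap.opNorm_le_bound (by positivity) fun v => ?_
  have h := H u hu _ x v hS
  rw [← ENNReal.ofReal_mul (by positivity), ENNReal.ofReal_le_ofReal_iff (by positivity), hw2] at h
  rw [div_mul_eq_mul_div, le_div_iff₀ hw0, Real.norm_eq_abs]
  refine (sq_le_sq₀ (by positivity) (by positivity)).1 ?_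
  rw [mul_pow, sq_abs, mul_pow, mul_pow, Real.sq_sqrt hC]
  linarith

/-- **Weighted Sobolev embedding on `ℝⁿ`**: if `s′ < s − n/2` and `δ′ < δ + n/2`, then there
is a constant `C = C(n, s, s′, δ, δ′)` such that every smooth `u` with finite
`H_{s,δ}(ℝⁿ)`-norm satisfies `σ(x)^{δ′+k} ‖Dᵏu(x)‖ ≤ C ‖u‖_{H_{s,δ}}` for all `0 ≤ k ≤ s′`. -/
theorem weighted_sobolev_embedding
    (n s s' : ℕ) (hn : 1 ≤ n) (δ δ' : ℝ)
    (hs : (s' : ℝ) < (s : ℝ) - n / 2) (hδ : δ' < δ + n / 2) :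
    ∃ C : ℝ, 0 < C ∧
      ∀ u : EuclideanSpace ℝ (Fin n) → ℝ, ContDiff ℝ (⊤ : ℕ∞) u → wSob n s δ u < ⊤ →
        ∀ k : ℕ, k ≤ s' → ∀ x : EuclideanSpace ℝ (Fin n),
          ENNReal.ofReal ((1 + ‖x‖ ^ 2) ^ ((δ' + (k : ℝ)) / 2) * ‖iteratedFDeriv ℝ k u x‖)
            ≤ ENNReal.ofReal C * wSob n s δ u := by
  obtain ⟨m, rfl⟩ : ∃ m, s = s' + (m + 1) := by
    have : s' < s := by
      have : (s' : ℝ) < s := hs.trans_le (sub_le_self _ (by positivity))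
      exact_mod_cast this
    exact ⟨s - s' - 1, by omega⟩
  have hm : Module.finrank ℝ (EuclideanSpace ℝ (Fin n)) ≤ 2 * m + 1 := by
    have : (n : ℝ) < 2 * m + 2 := by push_cast at hs; linarith
    have : n < 2 * m + 2 := by exact_mod_cast this
    rw [finrank_euclideanSpace_fin]
    omega
  choose C hC H using
    exists_weighted_norm_iteratedFDeriv_le (volume : Measure (EuclideanSpace ℝ (Fin n))) hm δ
  refine ⟨1 + ∑ k ∈ Finset.range (s' + 1), C k,
    add_pos_of_pos_of_nonneg one_pos (Finset.sum_nonneg fun k _ => hC k),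
    fun u hu hfin k hk x => ?_⟩
  set N := wSob n (s' + (m + 1)) δ u with hN
  have hNr : N = ENNReal.ofReal N.toReal := (ENNReal.ofReal_toReal hfin.ne).symm
  have hsum : ∑ j ∈ Finset.range (m + 2), ∫⁻ z : EuclideanSpace ℝ (Fin n),
      ENNReal.ofReal ((1 + ‖z‖ ^ 2) ^ (δ + ((k + j : ℕ) : ℝ)) *
        ‖iteratedFDeriv ℝ (k + j) u z‖ ^ 2) ≤ ENNReal.ofReal (N.toReal ^ 2) := by
    have hN2 : ENNReal.ofReal (N.toReal ^ 2) = N ^ (2 : ℝ) := by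
      rw [ENNReal.ofReal_pow ENNReal.toReal_nonneg, ← hNr, ENNReal.rpow_two]
    rw [hN2, hN, wSob, ← ENNReal.rpow_mul]
    norm_num only
    rw [ENNReal.rpow_one]
    set f : ℕ → ENNReal := fun i => ∫⁻ z : EuclideanSpace ℝ (Fin n),
      ENNReal.ofReal ((1 + ‖z‖ ^ 2) ^ (δ + (i : ℝ)) * ‖iteratedFDeriv ℝ i u z‖ ^ 2)
    calc ∑ j ∈ Finset.range (m + 2), f (k + j)
        = ∑ i ∈ (Finset.range (m + 2)).image (k + ·), f i :=
          (Finset.sum_image fun _ _ _ _ h => Nat.add_left_cancel h).symm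
      _ ≤ ∑ i ∈ Finset.range (s' + (m + 1) + 1), f i := by
          refine Finset.sum_le_sum_of_subset fun i hi => ?_
          obtain ⟨j, hj, rfl⟩ := Finset.mem_image.1 hi
          have := Finset.mem_range.1 hj
          exact Finset.mem_range.2 (by omega)
  have hmain := H k u hu N.toReal x ENNReal.toReal_nonneg hsum
  rw [finrank_euclideanSpace_fin] at hmain
  have hCk : C k ≤ 1 + ∑ k ∈ Finset.range (s' + 1), C k :=
    (Finset.single_le_sum (fun i _ => hC i) (Finset.mem_range.2 (Nat.lt_succ_of_le hk))).trans
      (le_add_of_nonneg_left zero_le_one)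
  rw [hNr, ← ENNReal.ofReal_mul ((hC k).trans hCk)]
  refine ENNReal.ofReal_le_ofReal (le_trans ?_ (hmain.trans
    (mul_le_mul_of_nonneg_right hCk ENNReal.toReal_nonneg)))
  gcongr
  linarith [sq_nonneg ‖x‖]
end

section
/- Weighted Sobolev multiplication inequality on ℝⁿ: Let n ≥ 1, let s, s₁, s₂ ∈ ℕ and δ, δ₁, δ₂ ∈ ℝ satisfy s ≤ s₁, s ≤ s₂, s < s₁ + s₂ − n/2 and δ < δ₁ + δ₂ + n/2. Then there is a constant C, depending only on n, s, s₁, s₂, δ, δ₁, δ₂, such that for all smooth functions f₁, f₂ : ℝⁿ → ℝ with ‖f₁‖_{H_{s₁,δ₁}(ℝⁿ)} < ∞ and ‖f₂‖_{H_{s₂,δ₂}(ℝⁿ)} < ∞, the product satisfies ‖f₁·f₂‖_{H_{s,δ}(ℝⁿ)} ≤ C ‖f₁‖_{H_{s₁,δ₁}(ℝⁿ)} ‖f₂‖_{H_{s₂,δ₂}(ℝⁿ)}. -/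
open MeasureTheory

open scoped ENNReal NNReal FourierTransform SchwartzMap LineDeriv

theorem inv_pow_mul_inv_pow_le_add {x y : ℝ} (hx : 0 < x) (hy : 0 < y) (a b : ℕ) :
    (x ^ a)⁻¹ * (y ^ b)⁻¹ ≤ (x ^ (a + b))⁻¹ + (y ^ (a + b))⁻¹ := by
  have hx' : 0 ≤ (x ^ (a + b))⁻¹ := by positivity
  have hy' : 0 ≤ (y ^ (a + b))⁻¹ := by positivity
  rcases le_total x y with h | h
  · have : (x ^ a)⁻¹ * (y ^ b)⁻¹ ≤ (x ^ (a + b))⁻¹ := by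
      rw [pow_add, mul_inv]; gcongr
    linarith
  · have : (x ^ a)⁻¹ * (y ^ b)⁻¹ ≤ (y ^ (a + b))⁻¹ := by
      rw [pow_add, mul_inv]; gcongr
    linarith

theorem lintegral_comp_smul_of_pos {n : ℕ} {f : EuclideanSpace ℝ (Fin n) → ℝ≥0∞}
    (hf : Measurable f) {r : ℝ} (hr : 0 < r) :
    ∫⁻ x, f (r • x) = ENNReal.ofReal (r ^ n)⁻¹ * ∫⁻ x, f x := by
  have h := Measure.map_addHaar_smul (volume : Measure (EuclideanSpace ℝ (Fin n))) hr.ne'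
  rw [← lintegral_map (g := fun x => r • x) hf (by fun_prop), h, lintegral_smul_measure]
  simp [abs_of_pos hr]

/-- The kernel of the weighted Young inequality is integrable, uniformly in `ξ`. -/
theorem exists_lintegral_kernel_le (n a b : ℕ) (hab : n < 2 * (a + b)) :
    ∃ K : ℝ≥0, ∀ r : ℝ, 0 < r → ∀ ξ : EuclideanSpace ℝ (Fin n),
      ∫⁻ η, ENNReal.ofReal (((1 + ‖r • (ξ - η)‖ ^ 2) ^ a)⁻¹ * ((1 + ‖r • η‖ ^ 2) ^ b)⁻¹)
        ≤ K * ENNReal.ofReal (r ^ n)⁻¹ := by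
  set g : EuclideanSpace ℝ (Fin n) → ℝ≥0∞ :=
    fun η => ENNReal.ofReal ((1 + ‖η‖ ^ 2) ^ (a + b))⁻¹ with hg
  have hgm : Measurable g := by fun_prop
  have hfin : ∫⁻ η, g η ≠ ∞ := by
    have h := (integrable_rpow_neg_one_add_norm_sq
      (μ := (volume : Measure (EuclideanSpace ℝ (Fin n)))) (r := (2 * (a + b) : ℕ))
      (by simpa using mod_cast hab)).lintegral_lt_top
    refine ((lintegral_congr fun η => ?_).trans_lt h).ne
    simp only [hg]
    congr 1
    rw [← Real.rpow_natCast, ← Real.rpow_neg (by positivity)]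
    congr 1
    push_cast
    ring
  refine ⟨2 * (∫⁻ η, g η).toNNReal, fun r hr ξ => ?_⟩
  calc
    _ ≤ ∫⁻ η, (g (r • (ξ - η)) + g (r • η)) := by
      refine lintegral_mono fun η => ?_
      simp only [hg]
      rw [← ENNReal.ofReal_add (by positivity) (by positivity)]
      exact ENNReal.ofReal_le_ofReal (inv_pow_mul_inv_pow_le_add (by positivity) (by positivity) a b)
    _ = 2 * (ENNReal.ofReal (r ^ n)⁻¹ * ∫⁻ η, g η) := by
      rw [lintegral_add_left (by fun_prop),
        lintegral_sub_left_eq_self (fun η => g (r • η)) ξ, lintegral_comp_smul_of_pos hgm hr,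
        two_mul]
    _ = _ := by
      rw [ENNReal.coe_mul, ENNReal.coe_toNNReal hfin]
      push_cast
      ring

/-- Weighted Young inequality in `L²`. -/
theorem lintegral_conv_sq_le {E : Type*} [NormedAddCommGroup E] [MeasurableSpace E] [BorelSpace E]
    [SecondCountableTopology E] {μ : Measure E} [SFinite μ] [μ.IsAddLeftInvariant]
    {F G v w : E → ℝ≥0∞} (hF : Measurable F) (hG : Measurable G) (hv : Measurable v)
    (hw : Measurable w) (hv0 : ∀ x, v x ≠ 0) (hv1 : ∀ x, v x ≠ ∞) (hw0 : ∀ x, w x ≠ 0)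
    (hw1 : ∀ x, w x ≠ ∞) {K : ℝ≥0∞} (hK : ∀ ξ, ∫⁻ η, (v (ξ - η))⁻¹ * (w η)⁻¹ ∂μ ≤ K) :
    ∫⁻ ξ, (∫⁻ η, F (ξ - η) * G η ∂μ) ^ 2 ∂μ
      ≤ K * ((∫⁻ ξ, v ξ * F ξ ^ 2 ∂μ) * ∫⁻ ξ, w ξ * G ξ ^ 2 ∂μ) := by
  have key (ξ : E) : (∫⁻ η, F (ξ - η) * G η ∂μ) ^ 2
      ≤ K * ∫⁻ η, (v (ξ - η) * F (ξ - η) ^ 2) * (w η * G η ^ 2) ∂μ := by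
    have h := ENNReal.lintegral_mul_le_Lp_mul_Lq μ Real.HolderConjugate.two_two
      (f := fun η => ((v (ξ - η))⁻¹ * (w η)⁻¹) ^ (1 / 2 : ℝ))
      (g := fun η => ((v (ξ - η) * F (ξ - η) ^ 2) * (w η * G η ^ 2)) ^ (1 / 2 : ℝ))
      (by fun_prop) (by fun_prop)
    have e (x : ℝ≥0∞) : (x ^ (1 / 2 : ℝ)) ^ 2 = x := by
      rw [← ENNReal.rpow_natCast, ← ENNReal.rpow_mul]; norm_num
    have e' (x : ℝ≥0∞) : (x ^ 2) ^ (1 / 2 : ℝ) = x := by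
      rw [← ENNReal.rpow_natCast, ← ENNReal.rpow_mul]; norm_num
    have e2 (x : ℝ≥0∞) : (x ^ (1 / 2 : ℝ)) ^ (2 : ℝ) = x := by
      rw [← ENNReal.rpow_mul]; norm_num
    simp only [e2, Pi.mul_apply] at h
    have h2 : ∫⁻ η, F (ξ - η) * G η ∂μ = ∫⁻ η, ((v (ξ - η))⁻¹ * (w η)⁻¹) ^ (1 / 2 : ℝ) *
        ((v (ξ - η) * F (ξ - η) ^ 2) * (w η * G η ^ 2)) ^ (1 / 2 : ℝ) ∂μ := by
      refine lintegral_congr fun η => ?_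
      rw [← ENNReal.mul_rpow_of_nonneg _ _ (by norm_num : (0 : ℝ) ≤ 1 / 2)]
      have : (v (ξ - η))⁻¹ * (w η)⁻¹ * (v (ξ - η) * F (ξ - η) ^ 2 * (w η * G η ^ 2))
          = (F (ξ - η) * G η) ^ 2 := by
        calc _ = ((v (ξ - η))⁻¹ * v (ξ - η)) * ((w η)⁻¹ * w η) * (F (ξ - η) * G η) ^ 2 := by ring
          _ = _ := by
            rw [ENNReal.inv_mul_cancel (hv0 _) (hv1 _), ENNReal.inv_mul_cancel (hw0 _) (hw1 _)]
            simp
      rw [this, e']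
    rw [h2]
    refine (pow_le_pow_left' h 2).trans ?_
    rw [mul_pow, e, e]
    gcongr
    exact hK ξ
  calc
    _ ≤ ∫⁻ ξ, K * ∫⁻ η, (v (ξ - η) * F (ξ - η) ^ 2) * (w η * G η ^ 2) ∂μ ∂μ := lintegral_mono key
    _ = K * ∫⁻ ξ, ∫⁻ η, (v (ξ - η) * F (ξ - η) ^ 2) * (w η * G η ^ 2) ∂μ ∂μ := by
      refine lintegral_const_mul _ ?_
      exact Measurable.lintegral_prod_right' (f := fun p : E × E =>
        (v (p.1 - p.2) * F (p.1 - p.2) ^ 2) * (w p.2 * G p.2 ^ 2)) (by fun_prop)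
    _ = K * ∫⁻ η, ∫⁻ ξ, (v (ξ - η) * F (ξ - η) ^ 2) * (w η * G η ^ 2) ∂μ ∂μ := by
      rw [lintegral_lintegral_swap]
      exact (by fun_prop : Measurable fun p : E × E =>
        (v (p.1 - p.2) * F (p.1 - p.2) ^ 2) * (w p.2 * G p.2 ^ 2)).aemeasurable
    _ = _ := by
      congr 1
      rw [← lintegral_const_mul _ (by fun_prop)]
      refine lintegral_congr fun η => ?_
      rw [lintegral_mul_const _ (by fun_prop),
        lintegral_sub_right_eq_self (fun ξ => v ξ * F ξ ^ 2) η]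

theorem lintegral_enorm_sq_fourier {n : ℕ} (f : 𝓢(EuclideanSpace ℝ (Fin n), ℂ)) :
    ∫⁻ ξ, ‖𝓕 f ξ‖ₑ ^ 2 = ∫⁻ x, ‖f x‖ₑ ^ 2 := by
  have key (g : 𝓢(EuclideanSpace ℝ (Fin n), ℂ)) :
      ∫⁻ x, ‖g x‖ₑ ^ 2 = ENNReal.ofReal (∫ x, ‖g x‖ ^ 2) := by
    rw [ofReal_integral_eq_lintegral_ofReal]
    · simp only [ENNReal.ofReal_pow (norm_nonneg _), ofReal_norm]
    · exact (g.memLp 2).integrable_norm_pow (by norm_num)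
    · exact Filter.Eventually.of_forall fun x => by positivity
  rw [key, key, SchwartzMap.integral_norm_sq_fourier]

theorem lintegral_enorm_sq_fourierInv {n : ℕ} (f : 𝓢(EuclideanSpace ℝ (Fin n), ℂ)) :
    ∫⁻ ξ, ‖𝓕⁻ f ξ‖ₑ ^ 2 = ∫⁻ x, ‖f x‖ₑ ^ 2 := by
  rw [← lintegral_enorm_sq_fourier, FourierTransform.fourier_fourierInv_eq]

theorem lintegral_enorm_mul_sq_le_conv {n : ℕ} (U V : 𝓢(EuclideanSpace ℝ (Fin n), ℂ)) :
    ∫⁻ x, ‖U x * V x‖ₑ ^ 2 ≤ ∫⁻ ξ, (∫⁻ η, ‖𝓕⁻ U (ξ - η)‖ₑ * ‖𝓕⁻ V η‖ₑ) ^ 2 := by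
  set h := SchwartzMap.convolution (ContinuousLinearMap.mul ℂ ℂ) (𝓕⁻ V) (𝓕⁻ U) with hh
  have h1 (x) : U x * V x = 𝓕 h x := by
    rw [hh, SchwartzMap.fourier_convolution, FourierTransform.fourier_fourierInv_eq,
      FourierTransform.fourier_fourierInv_eq, SchwartzMap.pairing_apply_apply]
    simp [mul_comm]
  simp only [h1]
  rw [lintegral_enorm_sq_fourier]
  refine lintegral_mono fun ξ => ?_
  gcongr
  rw [hh, SchwartzMap.convolution_apply, convolution_def]
  refine (enorm_integral_le_lintegral_enorm _).trans_eq ?_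
  refine lintegral_congr fun η => ?_
  simp [enorm_mul, mul_comm]

theorem fourierInv_iteratedLineDerivOp_apply {n : ℕ} (f : 𝓢(EuclideanSpace ℝ (Fin n), ℂ))
    (m : EuclideanSpace ℝ (Fin n)) (i : ℕ) (ξ : EuclideanSpace ℝ (Fin n)) :
    𝓕⁻ (∂^{fun _ : Fin i => m} f) ξ
      = (-(2 * Real.pi * Complex.I) * (inner ℝ ξ m : ℝ)) ^ i * 𝓕⁻ f ξ := by
  have ht : (inner ℝ · m : EuclideanSpace ℝ (Fin n) → ℝ).HasTemperateGrowth := by fun_prop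
  induction i with
  | zero => simp
  | succ i ih =>
    rw [LineDeriv.iteratedLineDerivOp_succ_left, SchwartzMap.fourierInv_lineDerivOp_eq]
    have : (Fin.tail fun _ : Fin (i + 1) => m) = fun _ => m := rfl
    rw [this, _root_.smul_apply, SchwartzMap.smulLeftCLM_apply_apply ht, ih]
    simp only [smul_eq_mul, Complex.real_smul]
    ring

theorem exists_one_add_norm_sq_pow_le (n a : ℕ) :
    ∃ C : ℝ≥0, ∀ x : EuclideanSpace ℝ (Fin n),
      (1 + ‖x‖ ^ 2) ^ a ≤ C * (1 + ∑ j, (x j ^ 2) ^ a) := by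
  rcases a with _ | k
  · exact ⟨1, fun x => by simp⟩
  refine ⟨(n + 1) ^ k, fun x => ?_⟩
  have h := pow_sum_div_card_le_sum_pow (s := (Finset.univ : Finset (Option (Fin n))))
    (f := fun o => o.elim 1 fun j => x j ^ 2)
    (by rintro (_ | j) - <;> simp [sq_nonneg]) k
  rw [div_le_iff₀ (by simp; positivity)] at h
  simp only [Fintype.sum_option, Option.elim, Finset.card_univ, Fintype.card_option,
    Fintype.card_fin, one_pow] at h
  rw [EuclideanSpace.real_norm_sq_eq]
  push_cast at h ⊢
  linarith

theorem exists_lintegral_weight_fourierInv_le (n a : ℕ) :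
    ∃ C : ℝ≥0, ∀ r : ℝ, 0 < r → ∀ U : 𝓢(EuclideanSpace ℝ (Fin n), ℂ),
      ∫⁻ ξ, ENNReal.ofReal ((1 + ‖r • ξ‖ ^ 2) ^ a) * ‖𝓕⁻ U ξ‖ₑ ^ 2
        ≤ C * ∑ i ∈ Finset.range (a + 1),
          ENNReal.ofReal (r ^ (2 * i)) * ∫⁻ x, ‖iteratedFDeriv ℝ i U x‖ₑ ^ 2 := by
  obtain ⟨C, hC⟩ := exists_one_add_norm_sq_pow_le n a
  refine ⟨C * (1 + n), fun r hr U => ?_⟩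
  set S := ∑ i ∈ Finset.range (a + 1),
          ENNReal.ofReal (r ^ (2 * i)) * ∫⁻ x, ‖iteratedFDeriv ℝ i U x‖ₑ ^ 2 with hS
  have h0 : ∫⁻ ξ, ‖𝓕⁻ U ξ‖ₑ ^ 2 ≤ S := by
    rw [lintegral_enorm_sq_fourierInv]
    refine le_trans ?_ (Finset.single_le_sum (fun _ _ => zero_le)
      (Finset.mem_range.2 (Nat.succ_pos a)))
    simp only [mul_zero, pow_zero, ENNReal.ofReal_one, one_mul]
    exact lintegral_mono fun x => by rw [← ofReal_norm, ← ofReal_norm, norm_iteratedFDeriv_zero]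
  have h1 (j : Fin n) :
      ∫⁻ ξ, ENNReal.ofReal (((r • ξ) j ^ 2) ^ a) * ‖𝓕⁻ U ξ‖ₑ ^ 2 ≤ S := by
    refine le_trans ?_ (Finset.single_le_sum (fun _ _ => zero_le)
      (Finset.mem_range.2 (Nat.lt_succ_self a)))
    set m : EuclideanSpace ℝ (Fin n) := EuclideanSpace.single j 1
    calc
      _ ≤ ∫⁻ ξ, ENNReal.ofReal (r ^ (2 * a)) * ‖𝓕⁻ (∂^{fun _ : Fin a => m} U) ξ‖ₑ ^ 2 := by
        refine lintegral_mono fun ξ => ?_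
        rw [fourierInv_iteratedLineDerivOp_apply, enorm_mul, mul_pow, ← mul_assoc]
        gcongr
        rw [← ofReal_norm, ← ENNReal.ofReal_pow (by positivity),
          ← ENNReal.ofReal_mul (by positivity)]
        apply ENNReal.ofReal_le_ofReal
        have e : inner ℝ ξ m = ξ j := by
          rw [real_inner_comm]; simp [m, EuclideanSpace.inner_single_left]
        rw [e]
        simp only [norm_pow, norm_mul, norm_neg, Complex.norm_I, Complex.norm_real, mul_one,
          Complex.norm_ofNat, Real.norm_eq_abs, abs_of_pos Real.pi_pos]
        rw [pow_mul r, ← pow_mul (2 * Real.pi * _), mul_comm a 2, pow_mul (2 * Real.pi * _), ← mul_pow]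
        gcongr
        rw [PiLp.smul_apply, smul_eq_mul, mul_pow, mul_pow, sq_abs]
        have : 1 ≤ (2 * Real.pi) ^ 2 := one_le_pow₀ (by nlinarith [Real.pi_gt_three])
        have := mul_le_mul_of_nonneg_right this (sq_nonneg (ξ j))
        gcongr
        linarith
      _ = ENNReal.ofReal (r ^ (2 * a)) * ∫⁻ x, ‖(∂^{fun _ : Fin a => m} U) x‖ₑ ^ 2 := by
        rw [lintegral_const_mul _ (by fun_prop), lintegral_enorm_sq_fourierInv]
      _ ≤ _ := by
        gcongr with x
        rw [SchwartzMap.iteratedLineDerivOp_eq_iteratedFDeriv, ← ofReal_norm, ← ofReal_norm]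
        apply ENNReal.ofReal_le_ofReal
        refine (ContinuousMultilinearMap.le_opNorm _ _).trans ?_
        simp [m]
  calc
    _ ≤ ∫⁻ ξ, C * (‖𝓕⁻ U ξ‖ₑ ^ 2
          + ∑ j, ENNReal.ofReal (((r • ξ) j ^ 2) ^ a) * ‖𝓕⁻ U ξ‖ₑ ^ 2) := by
      refine lintegral_mono fun ξ => ?_
      rw [← Finset.sum_mul, ← one_add_mul, ← mul_assoc]
      gcongr
      refine (ENNReal.ofReal_le_ofReal (hC (r • ξ))).trans_eq ?_
      rw [ENNReal.ofReal_mul (by positivity), ENNReal.ofReal_add (by positivity)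
        (Finset.sum_nonneg fun _ _ => by positivity),
        ENNReal.ofReal_sum_of_nonneg fun _ _ => by positivity]
      simp
    _ = C * ((∫⁻ ξ, ‖𝓕⁻ U ξ‖ₑ ^ 2)
          + ∑ j, ∫⁻ ξ, ENNReal.ofReal (((r • ξ) j ^ 2) ^ a) * ‖𝓕⁻ U ξ‖ₑ ^ 2) := by
      rw [lintegral_const_mul _ (by fun_prop), lintegral_add_left (by fun_prop),
        lintegral_finsetSum _ (fun _ _ => by fun_prop)]
    _ ≤ C * (S + ∑ j : Fin n, S) := by
      gcongr with j
      exact h1 j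
    _ = _ := by
      simp
      ring

/-- Local multiplication estimate `L² ⊇ Hᵃ · Hᵇ` at scale `r`. -/
theorem exists_lintegral_mul_sq_le (n a b : ℕ) (hab : n < 2 * (a + b)) :
    ∃ K : ℝ≥0, ∀ r : ℝ, 0 < r → ∀ U V : EuclideanSpace ℝ (Fin n) → ℝ,
      ContDiff ℝ (⊤ : ℕ∞) U → ContDiff ℝ (⊤ : ℕ∞) V → HasCompactSupport U → HasCompactSupport V →
      ∫⁻ x, ‖U x * V x‖ₑ ^ 2 ≤ K * ENNReal.ofReal (r ^ n)⁻¹ *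
        ((∑ i ∈ Finset.range (a + 1),
          ENNReal.ofReal (r ^ (2 * i)) * ∫⁻ x, ‖iteratedFDeriv ℝ i U x‖ₑ ^ 2) *
        ∑ i ∈ Finset.range (b + 1),
          ENNReal.ofReal (r ^ (2 * i)) * ∫⁻ x, ‖iteratedFDeriv ℝ i V x‖ₑ ^ 2) := by
  obtain ⟨K, hK⟩ := exists_lintegral_kernel_le n a b hab
  obtain ⟨C₁, hC₁⟩ := exists_lintegral_weight_fourierInv_le n a
  obtain ⟨C₂, hC₂⟩ := exists_lintegral_weight_fourierInv_le n b
  refine ⟨K * (C₁ * C₂), fun r hr U V hU hV hU' hV' => ?_⟩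
  let c (W : EuclideanSpace ℝ (Fin n) → ℝ) (hW : ContDiff ℝ (⊤ : ℕ∞) W)
      (hW' : HasCompactSupport W) : 𝓢(EuclideanSpace ℝ (Fin n), ℂ) :=
    HasCompactSupport.toSchwartzMap (f := fun x => (W x : ℂ))
      (hW'.comp_left (g := fun t : ℝ => (t : ℂ)) (by simp))
      (Complex.ofRealCLM.contDiff.comp hW)
  have hc (W hW hW') (i : ℕ) (x) :
      ‖iteratedFDeriv ℝ i (c W hW hW') x‖ₑ = ‖iteratedFDeriv ℝ i W x‖ₑ := by
    rw [← ofReal_norm, ← ofReal_norm]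
    congr 1
    exact Complex.ofRealLI.norm_iteratedFDeriv_comp_left (f := W) (n := (⊤ : ℕ∞)) hW.contDiffAt
      (mod_cast le_top)
  have h := lintegral_conv_sq_le (μ := (volume : Measure (EuclideanSpace ℝ (Fin n))))
    (F := fun ξ => ‖𝓕⁻ (c U hU hU') ξ‖ₑ) (G := fun ξ => ‖𝓕⁻ (c V hV hV') ξ‖ₑ)
    (v := fun ξ => ENNReal.ofReal ((1 + ‖r • ξ‖ ^ 2) ^ a))
    (w := fun ξ => ENNReal.ofReal ((1 + ‖r • ξ‖ ^ 2) ^ b))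
    (by fun_prop) (by fun_prop) (by fun_prop) (by fun_prop)
    (fun _ => (ENNReal.ofReal_pos.2 (by positivity)).ne') (fun _ => ENNReal.ofReal_ne_top)
    (fun _ => (ENNReal.ofReal_pos.2 (by positivity)).ne') (fun _ => ENNReal.ofReal_ne_top)
    (K := K * ENNReal.ofReal (r ^ n)⁻¹) (fun ξ => by
      refine le_trans (le_of_eq (lintegral_congr fun η => ?_)) (hK r hr ξ)
      rw [ENNReal.ofReal_mul (by positivity), ENNReal.ofReal_inv_of_pos (by positivity),
        ENNReal.ofReal_inv_of_pos (by positivity)])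
  have hU2 := hC₁ r hr (c U hU hU')
  have hV2 := hC₂ r hr (c V hV hV')
  simp only [hc] at hU2 hV2
  calc
    _ = ∫⁻ x, ‖c U hU hU' x * c V hV hV' x‖ₑ ^ 2 := by
      refine lintegral_congr fun x => ?_
      change _ = ‖(U x : ℂ) * (V x : ℂ)‖ₑ ^ 2
      rw [← Complex.ofReal_mul, ← ofReal_norm, ← ofReal_norm, Complex.norm_real]
    _ ≤ _ := lintegral_enorm_mul_sq_le_conv _ _
    _ ≤ _ := h
    _ ≤ K * ENNReal.ofReal (r ^ n)⁻¹ * ((C₁ * _) * (C₂ * _)) := by gcongr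
    _ = _ := by push_cast; ring

/-- A component of `D^p f` with respect to the standard basis. -/
noncomputable def iteratedPartial {n : ℕ} (f : EuclideanSpace ℝ (Fin n) → ℝ) {p : ℕ}
    (I : Fin p → Fin n) (x : EuclideanSpace ℝ (Fin n)) : ℝ :=
  iteratedFDeriv ℝ p f x fun j => EuclideanSpace.single (I j) 1

theorem contDiff_iteratedPartial {n : ℕ} {f : EuclideanSpace ℝ (Fin n) → ℝ}
    (hf : ContDiff ℝ (⊤ : ℕ∞) f) {p : ℕ} (I : Fin p → Fin n) :
    ContDiff ℝ (⊤ : ℕ∞) (iteratedPartial f I) :=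
  (ContinuousLinearMap.contDiff (ContinuousMultilinearMap.apply ℝ
    (fun _ : Fin p => EuclideanSpace ℝ (Fin n)) ℝ fun j => EuclideanSpace.single (I j) 1)).comp
      (hf.iteratedFDeriv_right (by exact_mod_cast le_top))

theorem iteratedPartial_succ {n : ℕ} {f : EuclideanSpace ℝ (Fin n) → ℝ}
    (hf : ContDiff ℝ (⊤ : ℕ∞) f) {p : ℕ} (I : Fin (p + 1) → Fin n) :
    iteratedPartial f I
      = fun x => fderiv ℝ (iteratedPartial f (Fin.tail I)) x (EuclideanSpace.single (I 0) 1) := by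
  funext x
  have hd : DifferentiableAt ℝ (iteratedFDeriv ℝ p f) x :=
    hf.differentiable_iteratedFDeriv (by exact_mod_cast ENat.natCast_lt_top p) x
  unfold iteratedPartial
  rw [iteratedFDeriv_succ_apply_left, fderiv_continuousMultilinear_apply_const_apply hd]
  rfl

theorem norm_iteratedFDeriv_iteratedPartial_le {n : ℕ} {f : EuclideanSpace ℝ (Fin n) → ℝ}
    (hf : ContDiff ℝ (⊤ : ℕ∞) f) {p : ℕ} (I : Fin p → Fin n) (m : ℕ)
    (x : EuclideanSpace ℝ (Fin n)) :
    ‖iteratedFDeriv ℝ m (iteratedPartial f I) x‖ ≤ ‖iteratedFDeriv ℝ (m + p) f x‖ := by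
  induction p generalizing m with
  | zero =>
    refine le_of_eq ?_
    congr 2
  | succ p ih =>
    have hc : ContDiff ℝ (⊤ : ℕ∞) (fderiv ℝ (iteratedPartial f (Fin.tail I))) :=
      (contDiff_iteratedPartial hf _).fderiv_right (by exact_mod_cast le_top)
    rw [iteratedPartial_succ hf]
    refine (norm_iteratedFDeriv_clm_apply_const hc.contDiffAt (by exact_mod_cast le_top)).trans ?_
    rw [norm_iteratedFDeriv_fderiv]
    rw [show m + (p + 1) = m + 1 + p by omega]
    simpa using ih (Fin.tail I) (m + 1)

theorem norm_le_sum_basis {n p : ℕ}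
    (T : ContinuousMultilinearMap ℝ (fun _ : Fin p => EuclideanSpace ℝ (Fin n)) ℝ) :
    ‖T‖ ≤ ∑ I : Fin p → Fin n, ‖T fun j => EuclideanSpace.single (I j) 1‖ := by
  refine T.opNorm_le_bound (Finset.sum_nonneg fun _ _ => norm_nonneg _) fun v => ?_
  have hv : v = fun j => ∑ i, v j i • EuclideanSpace.single i (1 : ℝ) := by
    funext j
    simpa using ((EuclideanSpace.basisFun (Fin n) ℝ).sum_repr (v j)).symm
  calc
    ‖T v‖ = ‖∑ I : Fin p → Fin n, (∏ j, v j (I j)) •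
        T fun j => EuclideanSpace.single (I j) 1‖ := by
      conv_lhs => rw [hv]
      rw [T.map_sum]
      simp only [T.map_smul_univ]
    _ ≤ ∑ I : Fin p → Fin n, (∏ j, ‖v j‖) * ‖T fun j => EuclideanSpace.single (I j) 1‖ := by
      refine norm_sum_le_of_le _ fun I _ => ?_
      rw [norm_smul, norm_prod]
      gcongr with j
      exact PiLp.norm_apply_le _ _
    _ = _ := by rw [← Finset.mul_sum, mul_comm]

theorem enorm_iteratedFDeriv_sq_le {n p : ℕ} (f : EuclideanSpace ℝ (Fin n) → ℝ)
    (x : EuclideanSpace ℝ (Fin n)) :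
    ‖iteratedFDeriv ℝ p f x‖ₑ ^ 2
      ≤ (n ^ p : ℕ) * ∑ I : Fin p → Fin n, ‖iteratedPartial f I x‖ₑ ^ 2 := by
  have h := (pow_le_pow_left₀ (norm_nonneg _) (norm_le_sum_basis (iteratedFDeriv ℝ p f x)) 2).trans
    sq_sum_le_card_mul_sum_sq
  simp only [Finset.card_univ, Fintype.card_fun, Fintype.card_fin] at h
  have h' := ENNReal.ofReal_le_ofReal h
  rw [ENNReal.ofReal_mul (by positivity), ENNReal.ofReal_natCast,
    ENNReal.ofReal_sum_of_nonneg fun _ _ => by positivity] at h'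
  simpa only [ENNReal.ofReal_pow (norm_nonneg _), ofReal_norm, iteratedPartial] using h'

/-- Rescaled cutoffs, with the scale-invariant derivative bounds. -/
theorem exists_cutoff (n a : ℕ) :
    ∃ M : ℝ≥0, ∀ r : ℝ, 0 < r → ∀ x₀ : EuclideanSpace ℝ (Fin n),
      ∃ χ : EuclideanSpace ℝ (Fin n) → ℝ, ContDiff ℝ (⊤ : ℕ∞) χ ∧ HasCompactSupport χ ∧
        (∀ x ∈ Metric.closedBall x₀ (r / 2), χ x = 1) ∧
        tsupport χ ⊆ Metric.closedBall x₀ r ∧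
        ∀ i ≤ a, ∀ x, r ^ i * ‖iteratedFDeriv ℝ i χ x‖ ≤ M := by
  let φ : ContDiffBump (0 : EuclideanSpace ℝ (Fin n)) := ⟨1 / 2, 1, by norm_num, by norm_num⟩
  have hφ : ContDiff ℝ (⊤ : ℕ∞) φ := φ.contDiff
  have hb (i : ℕ) : ∃ M : ℝ≥0, ∀ x, ‖iteratedFDeriv ℝ i φ x‖ ≤ M := by
    obtain ⟨x, hx⟩ := ((hφ.continuous_iteratedFDeriv (m := i) (by exact_mod_cast le_top)).norm
      ).exists_forall_ge_of_hasCompactSupport (φ.hasCompactSupport.iteratedFDeriv i).norm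
    exact ⟨‖iteratedFDeriv ℝ i φ x‖₊, hx⟩
  choose M hM using hb
  refine ⟨∑ i ∈ Finset.range (a + 1), M i, fun r hr x₀ => ?_⟩
  have hs : tsupport (fun x => φ (r⁻¹ • (x - x₀))) ⊆ Metric.closedBall x₀ r := by
    refine closure_minimal (fun x hx => ?_) Metric.isClosed_closedBall
    have hx' : r⁻¹ • (x - x₀) ∈ Metric.ball (0 : EuclideanSpace ℝ (Fin n)) 1 := by
      rw [← show φ.rOut = 1 from rfl, ← φ.support_eq]
      exact hx
    rw [mem_ball_zero_iff, norm_smul, norm_inv, Real.norm_of_nonneg hr.le, inv_mul_lt_one₀ hr] at hx'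
    exact mem_closedBall_iff_norm.2 hx'.le
  refine ⟨fun x => φ (r⁻¹ • (x - x₀)), by fun_prop,
    (isCompact_closedBall x₀ r).of_isClosed_subset (isClosed_tsupport _) hs, fun x hx => ?_, hs,
    fun i hi x => ?_⟩
  · apply φ.one_of_mem_closedBall
    rw [mem_closedBall_zero_iff, norm_smul, norm_inv, Real.norm_of_nonneg hr.le,
      inv_mul_le_iff₀ hr, show φ.rIn = 1 / 2 from rfl]
    rw [mem_closedBall_iff_norm] at hx
    linarith
  · rw [iteratedFDeriv_comp_sub (f := fun x => φ (r⁻¹ • x)),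
      iteratedFDeriv_comp_const_smul _ (hφ.of_le (by exact_mod_cast le_top))]
    simp only [norm_smul, norm_pow, norm_inv, Real.norm_of_nonneg hr.le]
    rw [← mul_assoc, ← mul_pow, mul_inv_cancel₀ hr.ne', one_pow, one_mul]
    refine (hM i _).trans ?_
    exact_mod_cast Finset.single_le_sum (f := M) (fun _ _ => zero_le)
      (Finset.mem_range.2 (Nat.lt_succ_of_le hi))

/-- Cutting off at scale `r` costs only the scale-invariant Sobolev norm on the ball. -/
theorem pow_mul_norm_iteratedFDeriv_cutoff_mul_sq_le {E : Type*} [NormedAddCommGroup E]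
    [NormedSpace ℝ E] {χ W : E → ℝ}
    (hχ : ContDiff ℝ (⊤ : ℕ∞) χ) (hW : ContDiff ℝ (⊤ : ℕ∞) W) {M r : ℝ} (hr : 0 < r) {a i : ℕ}
    (hi : i ≤ a) {x : E} (hM : ∀ i ≤ a, r ^ i * ‖iteratedFDeriv ℝ i χ x‖ ≤ M) :
    r ^ (2 * i) * ‖iteratedFDeriv ℝ i (fun y => χ y * W y) x‖ ^ 2
      ≤ (a + 1) * (2 ^ a * M) ^ 2 *
        ∑ m ∈ Finset.range (a + 1), r ^ (2 * m) * ‖iteratedFDeriv ℝ m W x‖ ^ 2 := by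
  have hM0 : 0 ≤ M := (by positivity : (0 : ℝ) ≤ _).trans (hM 0 (Nat.zero_le _))
  have h1 : r ^ i * ‖iteratedFDeriv ℝ i (fun y => χ y * W y) x‖
      ≤ (2 ^ a * M) * ∑ m ∈ Finset.range (a + 1), r ^ m * ‖iteratedFDeriv ℝ m W x‖ := by
    calc
      _ ≤ r ^ i * ∑ j ∈ Finset.range (i + 1), (i.choose j : ℝ) * ‖iteratedFDeriv ℝ j χ x‖ *
          ‖iteratedFDeriv ℝ (i - j) W x‖ := by
        gcongr
        exact norm_iteratedFDeriv_mul_le hχ hW x (by exact_mod_cast le_top)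
      _ = ∑ j ∈ Finset.range (i + 1), (i.choose j : ℝ) * (r ^ j * ‖iteratedFDeriv ℝ j χ x‖) *
          (r ^ (i - j) * ‖iteratedFDeriv ℝ (i - j) W x‖) := by
        rw [Finset.mul_sum]
        refine Finset.sum_congr rfl fun j hj => ?_
        rw [← pow_mul_pow_sub r (Finset.mem_range_succ_iff.1 hj)]
        ring
      _ ≤ ∑ j ∈ Finset.range (i + 1), (2 ^ a * M) *
          (r ^ (i - j) * ‖iteratedFDeriv ℝ (i - j) W x‖) := by
        gcongr with j hj
        · exact_mod_cast (Nat.choose_le_two_pow i j).trans (Nat.pow_le_pow_right (by norm_num) hi)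
        · exact hM j ((Finset.mem_range_succ_iff.1 hj).trans hi)
      _ = (2 ^ a * M) * ∑ j ∈ Finset.range (i + 1), r ^ j * ‖iteratedFDeriv ℝ j W x‖ := by
        rw [← Finset.mul_sum,
          ← Finset.sum_range_reflect (fun j => r ^ j * ‖iteratedFDeriv ℝ j W x‖)]
        simp
      _ ≤ _ := by
        gcongr
  calc
    _ = (r ^ i * ‖iteratedFDeriv ℝ i (fun y => χ y * W y) x‖) ^ 2 := by ring
    _ ≤ ((2 ^ a * M) * ∑ m ∈ Finset.range (a + 1), r ^ m * ‖iteratedFDeriv ℝ m W x‖) ^ 2 := by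
      gcongr
    _ ≤ (2 ^ a * M) ^ 2 * ((a + 1 : ℕ) *
        ∑ m ∈ Finset.range (a + 1), (r ^ m * ‖iteratedFDeriv ℝ m W x‖) ^ 2) := by
      rw [mul_pow]
      gcongr
      simpa using sq_sum_le_card_mul_sum_sq (s := Finset.range (a + 1))
        (f := fun m => r ^ m * ‖iteratedFDeriv ℝ m W x‖)
    _ = _ := by
      push_cast
      rw [mul_left_comm, ← mul_assoc]
      congr 1
      refine Finset.sum_congr rfl fun m _ => ?_
      ring

/-- The scale-invariant (squared) Sobolev norm of order `a` of `D^p f` on a ball. -/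
noncomputable def ballEnergy {n : ℕ} (a p : ℕ) (r : ℝ) (x₀ : EuclideanSpace ℝ (Fin n))
    (f : EuclideanSpace ℝ (Fin n) → ℝ) : ℝ≥0∞ :=
  ∑ m ∈ Finset.range (a + 1), ENNReal.ofReal (r ^ (2 * m)) *
    ∫⁻ x in Metric.closedBall x₀ r, ‖iteratedFDeriv ℝ (m + p) f x‖ₑ ^ 2

theorem measurable_enorm_iteratedFDeriv_sq {n : ℕ} {f : EuclideanSpace ℝ (Fin n) → ℝ}
    (hf : ContDiff ℝ (⊤ : ℕ∞) f) (m : ℕ) :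
    Measurable fun x => ‖iteratedFDeriv ℝ m f x‖ₑ ^ 2 :=
  (hf.continuous_iteratedFDeriv (m := m) (by exact_mod_cast le_top)).enorm.measurable.pow_const 2

theorem lintegral_cutoff_mul_iteratedPartial_le {n a p : ℕ} {M : ℝ≥0} {r : ℝ} (hr : 0 < r)
    {x₀ : EuclideanSpace ℝ (Fin n)} {χ f : EuclideanSpace ℝ (Fin n) → ℝ}
    (hχ : ContDiff ℝ (⊤ : ℕ∞) χ) (hχs : tsupport χ ⊆ Metric.closedBall x₀ r)
    (hM : ∀ i ≤ a, ∀ x, r ^ i * ‖iteratedFDeriv ℝ i χ x‖ ≤ M)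
    (hf : ContDiff ℝ (⊤ : ℕ∞) f) (I : Fin p → Fin n) :
    ∑ i ∈ Finset.range (a + 1), ENNReal.ofReal (r ^ (2 * i)) *
        ∫⁻ x, ‖iteratedFDeriv ℝ i (fun y => χ y * iteratedPartial f I y) x‖ₑ ^ 2
      ≤ ((a + 1) * ((a + 1) * (2 ^ a * M) ^ 2) : ℝ≥0) * ballEnergy a p r x₀ f := by
  have hW := contDiff_iteratedPartial hf I
  set K : ℝ≥0 := (a + 1) * (2 ^ a * M) ^ 2 with hK
  have hpt : ∀ i ∈ Finset.range (a + 1), ∀ x,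
      ENNReal.ofReal (r ^ (2 * i)) *
        ‖iteratedFDeriv ℝ i (fun y => χ y * iteratedPartial f I y) x‖ₑ ^ 2
      ≤ (Metric.closedBall x₀ r).indicator (fun x => K * ∑ m ∈ Finset.range (a + 1),
          ENNReal.ofReal (r ^ (2 * m)) * ‖iteratedFDeriv ℝ (m + p) f x‖ₑ ^ 2) x := by
    intro i hi x
    by_cases hx : x ∈ Metric.closedBall x₀ r
    · rw [Set.indicator_of_mem hx]
      have h := pow_mul_norm_iteratedFDeriv_cutoff_mul_sq_le hχ hW hr
        (Finset.mem_range_succ_iff.1 hi) (fun i hi => hM i hi x)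
      have h' : r ^ (2 * i) * ‖iteratedFDeriv ℝ i (fun y => χ y * iteratedPartial f I y) x‖ ^ 2
          ≤ K * ∑ m ∈ Finset.range (a + 1), r ^ (2 * m) * ‖iteratedFDeriv ℝ (m + p) f x‖ ^ 2 := by
        refine h.trans ?_
        rw [hK]
        push_cast
        gcongr with m
        exact norm_iteratedFDeriv_iteratedPartial_le hf I m x
      have h'' := ENNReal.ofReal_le_ofReal h'
      rw [ENNReal.ofReal_mul (by positivity), ENNReal.ofReal_mul (by positivity),
        ENNReal.ofReal_sum_of_nonneg fun _ _ => by positivity, ENNReal.ofReal_coe_nnreal] at h''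
      simpa only [ENNReal.ofReal_mul (pow_nonneg hr.le _), ENNReal.ofReal_pow (norm_nonneg _),
        ofReal_norm] using h''
    · have h0 : iteratedFDeriv ℝ i (fun y => χ y * iteratedPartial f I y) x = 0 := by
        by_contra h
        exact hx (hχs (tsupport_mul_subset_left (support_iteratedFDeriv_subset i h)))
      simp [h0]
  have hmeas := measurable_enorm_iteratedFDeriv_sq hf
  calc
    _ ≤ ∑ i ∈ Finset.range (a + 1), K * ballEnergy a p r x₀ f := by
      refine Finset.sum_le_sum fun i hi => ?_
      rw [← lintegral_const_mul' _ _ ENNReal.ofReal_ne_top]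
      refine (lintegral_mono (hpt i hi)).trans_eq ?_
      rw [lintegral_indicator Metric.isClosed_closedBall.measurableSet,
        lintegral_const_mul' _ _ ENNReal.coe_ne_top,
        lintegral_finsetSum _ fun m _ => (hmeas _).const_mul _]
      simp only [lintegral_const_mul' _ _ ENNReal.ofReal_ne_top, ballEnergy]
    _ = _ := by
      rw [Finset.sum_const, Finset.card_range, nsmul_eq_mul, ← mul_assoc]
      push_cast
      rfl

/-- Scale-invariant multiplication estimate on a ball. -/
theorem exists_lintegral_closedBall_mul_sq_le (n p q a b : ℕ) (hab : n < 2 * (a + b)) :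
    ∃ K : ℝ≥0, ∀ r : ℝ, 0 < r → ∀ (x₀ : EuclideanSpace ℝ (Fin n))
      (f₁ f₂ : EuclideanSpace ℝ (Fin n) → ℝ),
      ContDiff ℝ (⊤ : ℕ∞) f₁ → ContDiff ℝ (⊤ : ℕ∞) f₂ →
      ∫⁻ x in Metric.closedBall x₀ (r / 2),
          ‖iteratedFDeriv ℝ p f₁ x‖ₑ ^ 2 * ‖iteratedFDeriv ℝ q f₂ x‖ₑ ^ 2
        ≤ K * ENNReal.ofReal (r ^ n)⁻¹ * (ballEnergy a p r x₀ f₁ * ballEnergy b q r x₀ f₂) := by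
  obtain ⟨K, hK⟩ := exists_lintegral_mul_sq_le n a b hab
  obtain ⟨M, hM⟩ := exists_cutoff n a
  obtain ⟨N, hN⟩ := exists_cutoff n b
  let A : ℝ≥0 := (a + 1) * ((a + 1) * (2 ^ a * M) ^ 2)
  let B : ℝ≥0 := (b + 1) * ((b + 1) * (2 ^ b * N) ^ 2)
  refine ⟨(n ^ p : ℕ) * (n ^ q : ℕ) * (n ^ p : ℕ) * (n ^ q : ℕ) * (K * A * B),
    fun r hr x₀ f₁ f₂ hf₁ hf₂ => ?_⟩
  obtain ⟨χ, hχ, hχc, hχ1, hχs, hχM⟩ := hM r hr x₀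
  obtain ⟨ψ, hψ, hψc, hψ1, hψs, hψN⟩ := hN r hr x₀
  have hm₁ (I : Fin p → Fin n) := (contDiff_iteratedPartial hf₁ I).continuous
  have hm₂ (I : Fin q → Fin n) := (contDiff_iteratedPartial hf₂ I).continuous
  have hcomp (I : Fin p → Fin n) (J : Fin q → Fin n) :
      ∫⁻ x in Metric.closedBall x₀ (r / 2), ‖iteratedPartial f₁ I x‖ₑ ^ 2 *
          ‖iteratedPartial f₂ J x‖ₑ ^ 2
        ≤ K * ENNReal.ofReal (r ^ n)⁻¹ *
          ((A * ballEnergy a p r x₀ f₁) * (B * ballEnergy b q r x₀ f₂)) := by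
    calc
      _ = ∫⁻ x in Metric.closedBall x₀ (r / 2), ‖(χ x * iteratedPartial f₁ I x) *
          (ψ x * iteratedPartial f₂ J x)‖ₑ ^ 2 := by
        refine setLIntegral_congr_fun Metric.isClosed_closedBall.measurableSet fun x hx => ?_
        simp only [hχ1 x hx, hψ1 x hx, one_mul, enorm_mul, mul_pow]
      _ ≤ ∫⁻ x, ‖(χ x * iteratedPartial f₁ I x) * (ψ x * iteratedPartial f₂ J x)‖ₑ ^ 2 :=
        setLIntegral_le_lintegral _ _
      _ ≤ _ := hK r hr _ _ (hχ.mul (contDiff_iteratedPartial hf₁ I))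
        (hψ.mul (contDiff_iteratedPartial hf₂ J)) hχc.mul_right hψc.mul_right
      _ ≤ _ := by
        gcongr
        · exact lintegral_cutoff_mul_iteratedPartial_le hr hχ hχs hχM hf₁ I
        · exact lintegral_cutoff_mul_iteratedPartial_le hr hψ hψs hψN hf₂ J
  calc
    _ ≤ ∫⁻ x in Metric.closedBall x₀ (r / 2), ((n ^ p : ℕ) * (n ^ q : ℕ) : ℝ≥0∞) *
        ∑ I : Fin p → Fin n, ∑ J : Fin q → Fin n,
          ‖iteratedPartial f₁ I x‖ₑ ^ 2 * ‖iteratedPartial f₂ J x‖ₑ ^ 2 := by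
      refine lintegral_mono fun x => ?_
      rw [← Finset.sum_mul_sum, mul_mul_mul_comm]
      exact mul_le_mul' (enorm_iteratedFDeriv_sq_le f₁ x) (enorm_iteratedFDeriv_sq_le f₂ x)
    _ = ((n ^ p : ℕ) * (n ^ q : ℕ) : ℝ≥0∞) * ∑ I : Fin p → Fin n, ∑ J : Fin q → Fin n,
        ∫⁻ x in Metric.closedBall x₀ (r / 2),
          ‖iteratedPartial f₁ I x‖ₑ ^ 2 * ‖iteratedPartial f₂ J x‖ₑ ^ 2 := by
      have hmm (I : Fin p → Fin n) (J : Fin q → Fin n) : Measurable fun x =>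
          ‖iteratedPartial f₁ I x‖ₑ ^ 2 * ‖iteratedPartial f₂ J x‖ₑ ^ 2 :=
        ((hm₁ I).enorm.measurable.pow_const 2).mul ((hm₂ J).enorm.measurable.pow_const 2)
      rw [lintegral_const_mul _ (Finset.measurable_fun_sum _ fun I _ =>
          Finset.measurable_fun_sum _ fun J _ => hmm I J),
        lintegral_finsetSum _ fun I _ => Finset.measurable_fun_sum _ fun J _ => hmm I J]
      simp only [lintegral_finsetSum _ fun J _ => hmm _ J]
    _ ≤ ((n ^ p : ℕ) * (n ^ q : ℕ) : ℝ≥0∞) * ∑ _I : Fin p → Fin n, ∑ _J : Fin q → Fin n,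
        K * ENNReal.ofReal (r ^ n)⁻¹ *
          ((A * ballEnergy a p r x₀ f₁) * (B * ballEnergy b q r x₀ f₂)) := by
      gcongr with I _ J _
      exact hcomp I J
    _ = _ := by
      simp only [Finset.sum_const, Finset.card_univ, Fintype.card_fun, Fintype.card_fin,
        nsmul_eq_mul]
      push_cast
      ring

/-- Half of the weight `σ`: the radius of the ball around `x` on which the weight is essentially
constant. -/
noncomputable def localRadius {n : ℕ} (x : EuclideanSpace ℝ (Fin n)) : ℝ :=
  √(1 + ‖x‖ ^ 2) / 2

theorem localRadius_pos {n : ℕ} (x : EuclideanSpace ℝ (Fin n)) : 0 < localRadius x := by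
  unfold localRadius
  positivity

theorem one_add_norm_sq_eq {n : ℕ} (x : EuclideanSpace ℝ (Fin n)) :
    1 + ‖x‖ ^ 2 = 4 * localRadius x ^ 2 := by
  rw [localRadius, div_pow, Real.sq_sqrt (by positivity)]
  ring

theorem continuous_localRadius {n : ℕ} :
    Continuous (localRadius : EuclideanSpace ℝ (Fin n) → ℝ) := by
  unfold localRadius
  fun_prop

theorem localRadius_le_add {n : ℕ} (x y : EuclideanSpace ℝ (Fin n)) :
    localRadius x ≤ localRadius y + dist x y / 2 := by
  have hx := localRadius_pos x
  have hy := localRadius_pos y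
  have hd : ‖x‖ ≤ ‖y‖ + dist x y := by
    rw [dist_eq_norm]
    simpa [add_comm] using norm_add_le (x - y) y
  have hx2 := one_add_norm_sq_eq x
  have hy2 := one_add_norm_sq_eq y
  have hny : ‖y‖ ≤ 2 * localRadius y := by
    refine le_of_sq_le_sq ?_ (by positivity)
    nlinarith
  have hdist : 0 ≤ dist x y := dist_nonneg
  refine le_of_sq_le_sq ?_ (by positivity)
  nlinarith [norm_nonneg x, norm_nonneg y, mul_le_mul_of_nonneg_right hny hdist]

theorem localRadius_le_of_dist_le {n : ℕ} {x y : EuclideanSpace ℝ (Fin n)}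
    (h : dist x y ≤ localRadius y) :
    localRadius x ≤ 2 * localRadius y ∧ localRadius y ≤ 2 * localRadius x := by
  have h1 := localRadius_le_add x y
  have h2 := localRadius_le_add y x
  rw [dist_comm] at h2
  have := localRadius_pos y
  constructor <;> linarith

theorem rpow_le_four_rpow_abs_mul {a b : ℝ} (ha : 0 < a) (hb : 0 < b) (hab : a ≤ 4 * b)
    (hba : b ≤ 4 * a) (e : ℝ) : a ^ e ≤ 4 ^ |e| * b ^ e := by
  rcases le_total 0 e with he | he
  · rw [abs_of_nonneg he, ← Real.mul_rpow (by norm_num) hb.le]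
    exact Real.rpow_le_rpow ha.le hab he
  · have h : (4 : ℝ) ^ |e| * b ^ e = (b / 4) ^ e := by
      rw [abs_of_nonpos he, Real.div_rpow hb.le (by norm_num), Real.rpow_neg (by norm_num)]
      field_simp
    rw [h]
    exact Real.rpow_le_rpow_of_nonpos (by positivity) (by linarith) he

theorem one_add_norm_sq_rpow_le {n : ℕ} {x y : EuclideanSpace ℝ (Fin n)}
    (h : dist x y ≤ localRadius y) (e : ℝ) :
    (1 + ‖x‖ ^ 2) ^ e ≤ 4 ^ |e| * (1 + ‖y‖ ^ 2) ^ e ∧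
      (1 + ‖y‖ ^ 2) ^ e ≤ 4 ^ |e| * (1 + ‖x‖ ^ 2) ^ e := by
  obtain ⟨h1, h2⟩ := localRadius_le_of_dist_le h
  have hx := localRadius_pos x
  have hy := localRadius_pos y
  have h3 : 1 + ‖x‖ ^ 2 ≤ 4 * (1 + ‖y‖ ^ 2) := by
    rw [one_add_norm_sq_eq x, one_add_norm_sq_eq y]
    nlinarith
  have h4 : 1 + ‖y‖ ^ 2 ≤ 4 * (1 + ‖x‖ ^ 2) := by
    rw [one_add_norm_sq_eq x, one_add_norm_sq_eq y]
    nlinarith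
  exact ⟨rpow_le_four_rpow_abs_mul (by positivity) (by positivity) h3 h4 e,
    rpow_le_four_rpow_abs_mul (by positivity) (by positivity) h4 h3 e⟩

theorem lintegral_weight_mul_setLIntegral_closedBall {n : ℕ} (t : ℝ)
    {F : EuclideanSpace ℝ (Fin n) → ℝ≥0∞} (hF : Measurable F) :
    ∫⁻ y, ENNReal.ofReal (localRadius y ^ n)⁻¹ *
        ∫⁻ x in Metric.closedBall y (t * localRadius y), F x
      = ∫⁻ x, F x * ∫⁻ y in {y | dist x y ≤ t * localRadius y},
          ENNReal.ofReal (localRadius y ^ n)⁻¹ := by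
  have hR := continuous_localRadius (n := n)
  let S : Set (EuclideanSpace ℝ (Fin n) × EuclideanSpace ℝ (Fin n)) :=
    {z | dist z.2 z.1 ≤ t * localRadius z.1}
  have hS : MeasurableSet S :=
    (isClosed_le (by fun_prop) (by fun_prop)).measurableSet
  have hw : Measurable fun y : EuclideanSpace ℝ (Fin n) =>
      ENNReal.ofReal (localRadius y ^ n)⁻¹ := by
    have := hR.measurable
    fun_prop
  have hG : Measurable (S.indicator fun z => ENNReal.ofReal (localRadius z.1 ^ n)⁻¹ * F z.2) :=
    ((hw.comp measurable_fst).mul (hF.comp measurable_snd)).indicator hS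
  calc
    _ = ∫⁻ y, ∫⁻ x, S.indicator (fun z => ENNReal.ofReal (localRadius z.1 ^ n)⁻¹ * F z.2) (y, x) := by
      refine lintegral_congr fun y => ?_
      rw [← lintegral_const_mul' _ _ ENNReal.ofReal_ne_top,
        ← lintegral_indicator Metric.isClosed_closedBall.measurableSet]
      rfl
    _ = ∫⁻ x, ∫⁻ y, S.indicator (fun z => ENNReal.ofReal (localRadius z.1 ^ n)⁻¹ * F z.2) (y, x) :=
      lintegral_lintegral_swap hG.aemeasurable
    _ = _ := by
      refine lintegral_congr fun x => ?_
      have hSx : MeasurableSet {y | dist x y ≤ t * localRadius y} :=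
        (isClosed_le (by fun_prop) (by fun_prop)).measurableSet
      rw [← lintegral_const_mul _ hw, ← lintegral_indicator hSx]
      refine lintegral_congr fun y => ?_
      simp only [Set.indicator, S, Set.mem_ofPred_eq, mul_comm]

theorem ofReal_inv_pow_mul_volume_closedBall {n : ℕ} (x : EuclideanSpace ℝ (Fin n)) {r c : ℝ}
    (hr : 0 < r) (hc : 0 < c) :
    ENNReal.ofReal (r ^ n)⁻¹ * volume (Metric.closedBall x (c * r))
      = ENNReal.ofReal (c ^ n) * volume (Metric.ball (0 : EuclideanSpace ℝ (Fin n)) 1) := by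
  rw [Measure.addHaar_closedBall _ _ (by positivity), finrank_euclideanSpace_fin, ← mul_assoc,
    ← ENNReal.ofReal_mul (by positivity)]
  congr 2
  field_simp
  ring

theorem exists_lintegral_weight_closedBall_le (n : ℕ) :
    ∃ C : ℝ≥0, ∀ F : EuclideanSpace ℝ (Fin n) → ℝ≥0∞, Measurable F →
      ∫⁻ y, ENNReal.ofReal (localRadius y ^ n)⁻¹ *
          ∫⁻ x in Metric.closedBall y (localRadius y), F x ≤ C * ∫⁻ x, F x := by
  obtain ⟨v, hv⟩ : ∃ v : ℝ≥0, volume (Metric.ball (0 : EuclideanSpace ℝ (Fin n)) 1) = v :=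
    ⟨_, (ENNReal.coe_toNNReal Metric.isBounded_ball.measure_lt_top.ne).symm⟩
  refine ⟨4 ^ n * v, fun F hF => ?_⟩
  have h := lintegral_weight_mul_setLIntegral_closedBall 1 hF
  simp only [one_mul] at h
  rw [h, ← lintegral_const_mul _ hF]
  refine lintegral_mono fun x => ?_
  rw [mul_comm]
  gcongr
  have hx := localRadius_pos x
  calc
    _ ≤ ∫⁻ _ in {y | dist x y ≤ localRadius y}, ENNReal.ofReal ((localRadius x / 2) ^ n)⁻¹ := by
      refine setLIntegral_mono measurable_const fun y hy => ?_
      have := (localRadius_le_of_dist_le hy).1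
      gcongr
      linarith
    _ ≤ ∫⁻ _ in Metric.closedBall x (4 * (localRadius x / 2)),
        ENNReal.ofReal ((localRadius x / 2) ^ n)⁻¹ := by
      refine lintegral_mono_set fun y hy => ?_
      rw [Metric.mem_closedBall, dist_comm]
      have := (localRadius_le_of_dist_le hy).2
      rw [Set.mem_ofPred_eq] at hy
      linarith
    _ = _ := by
      rw [setLIntegral_const, ofReal_inv_pow_mul_volume_closedBall x (by positivity) (by norm_num),
        hv, ENNReal.ofReal_pow (by norm_num)]
      norm_num

theorem exists_lintegral_le_weight_closedBall (n : ℕ) :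
    ∃ C : ℝ≥0, ∀ F : EuclideanSpace ℝ (Fin n) → ℝ≥0∞, Measurable F →
      ∫⁻ x, F x ≤ C * ∫⁻ y, ENNReal.ofReal (localRadius y ^ n)⁻¹ *
        ∫⁻ x in Metric.closedBall y (localRadius y / 2), F x := by
  have hv0 : volume (Metric.ball (0 : EuclideanSpace ℝ (Fin n)) 1) ≠ 0 :=
    (Metric.measure_ball_pos _ _ one_pos).ne'
  obtain ⟨v, hv⟩ : ∃ v : ℝ≥0, volume (Metric.ball (0 : EuclideanSpace ℝ (Fin n)) 1) = v :=
    ⟨_, (ENNReal.coe_toNNReal Metric.isBounded_ball.measure_lt_top.ne).symm⟩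
  have hv1 : v ≠ 0 := by
    rw [hv] at hv0
    exact_mod_cast hv0
  refine ⟨((1 / 8) ^ n * v)⁻¹, fun F hF => ?_⟩
  have h := lintegral_weight_mul_setLIntegral_closedBall (1 / 2) hF
  simp only [one_div_mul_eq_div] at h
  rw [h]
  have hlow (x : EuclideanSpace ℝ (Fin n)) : (((1 / 8) ^ n * v : ℝ≥0) : ℝ≥0∞)
      ≤ ∫⁻ y in {y | dist x y ≤ localRadius y / 2}, ENNReal.ofReal (localRadius y ^ n)⁻¹ := by
    have hx := localRadius_pos x
    have hsub {y : EuclideanSpace ℝ (Fin n)}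
        (hy : y ∈ Metric.closedBall x (1 / 8 * (2 * localRadius x))) :
        dist x y ≤ localRadius y / 2 ∧ localRadius y ≤ 2 * localRadius x := by
      have h1 := localRadius_le_add x y
      have h2 := localRadius_le_add y x
      rw [Metric.mem_closedBall] at hy
      rw [dist_comm] at h1 ⊢
      constructor <;> linarith
    calc
      _ = ∫⁻ _ in Metric.closedBall x (1 / 8 * (2 * localRadius x)),
          ENNReal.ofReal ((2 * localRadius x) ^ n)⁻¹ := by
        rw [setLIntegral_const,
          ofReal_inv_pow_mul_volume_closedBall x (by positivity) (by norm_num), hv,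
          ENNReal.ofReal_pow (by norm_num), ENNReal.coe_mul, ENNReal.coe_pow]
        congr 2
        rw [← ENNReal.ofReal_coe_nnreal]
        norm_num
      _ ≤ ∫⁻ y in Metric.closedBall x (1 / 8 * (2 * localRadius x)),
          ENNReal.ofReal (localRadius y ^ n)⁻¹ := by
        refine setLIntegral_mono' Metric.isClosed_closedBall.measurableSet fun y hy => ?_
        have := localRadius_pos y
        gcongr
        exact (hsub hy).2
      _ ≤ _ := lintegral_mono_set fun y hy => (hsub hy).1
  have hc : ((1 / 8) ^ n * v : ℝ≥0) ≠ 0 := by positivity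
  calc
    ∫⁻ x, F x = (((1 / 8) ^ n * v : ℝ≥0)⁻¹ : ℝ≥0) *
        ∫⁻ x, F x * (((1 / 8) ^ n * v : ℝ≥0) : ℝ≥0∞) := by
      rw [lintegral_mul_const _ hF, mul_left_comm, ← ENNReal.coe_mul, inv_mul_cancel₀ hc]
      simp
    _ ≤ _ := by
      gcongr with x
      exact hlow x

/-- The integrand of the squared weighted Sobolev norm. -/
noncomputable def sobolevDensity {n : ℕ} (s : ℕ) (δ : ℝ) (f : EuclideanSpace ℝ (Fin n) → ℝ)
    (x : EuclideanSpace ℝ (Fin n)) : ℝ≥0∞ :=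
  ∑ k ∈ Finset.range (s + 1),
    ENNReal.ofReal ((1 + ‖x‖ ^ 2) ^ (δ + (k : ℝ))) * ‖iteratedFDeriv ℝ k f x‖ₑ ^ 2

theorem measurable_ofReal_weight {n : ℕ} (e : ℝ) :
    Measurable fun x : EuclideanSpace ℝ (Fin n) => ENNReal.ofReal ((1 + ‖x‖ ^ 2) ^ e) := by
  fun_prop

theorem measurable_sobolevDensity {n s : ℕ} {δ : ℝ} {f : EuclideanSpace ℝ (Fin n) → ℝ}
    (hf : ContDiff ℝ (⊤ : ℕ∞) f) : Measurable (sobolevDensity s δ f) :=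
  Finset.measurable_fun_sum _ fun k _ =>
    (measurable_ofReal_weight _).mul (measurable_enorm_iteratedFDeriv_sq hf k)

theorem wSob_eq {n s : ℕ} {δ : ℝ} {f : EuclideanSpace ℝ (Fin n) → ℝ}
    (hf : ContDiff ℝ (⊤ : ℕ∞) f) : wSob n s δ f = (∫⁻ x, sobolevDensity s δ f x) ^ (1 / 2 : ℝ) := by
  have hm (k : ℕ) : Measurable fun x : EuclideanSpace ℝ (Fin n) =>
      ENNReal.ofReal ((1 + ‖x‖ ^ 2) ^ (δ + (k : ℝ))) * ‖iteratedFDeriv ℝ k f x‖ₑ ^ 2 :=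
    (measurable_ofReal_weight _).mul (measurable_enorm_iteratedFDeriv_sq hf k)
  unfold wSob sobolevDensity
  rw [lintegral_finsetSum _ fun k _ => hm k]
  congr 1
  refine Finset.sum_congr rfl fun k _ => lintegral_congr fun x => ?_
  rw [ENNReal.ofReal_mul (by positivity), ENNReal.ofReal_pow (norm_nonneg _), ofReal_norm]

theorem exists_weight_mul_ballEnergy_le (n : ℕ) {s p : ℕ} (hp : p ≤ s) (δ : ℝ) :
    ∃ K : ℝ≥0, ∀ (y : EuclideanSpace ℝ (Fin n)) (f : EuclideanSpace ℝ (Fin n) → ℝ),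
      ENNReal.ofReal ((1 + ‖y‖ ^ 2) ^ (δ + (p : ℝ))) * ballEnergy (s - p) p (localRadius y) y f
        ≤ K * ∫⁻ x in Metric.closedBall y (localRadius y), sobolevDensity s δ f x := by
  refine ⟨∑ m ∈ Finset.range (s - p + 1), Real.toNNReal (4 ^ |δ + ((m + p : ℕ) : ℝ)|),
    fun y f => ?_⟩
  rw [ballEnergy, Finset.mul_sum, ENNReal.ofNNReal_finsetSum, Finset.sum_mul]
  refine Finset.sum_le_sum fun m hm => ?_
  have hmp : m + p ∈ Finset.range (s + 1) := by
    rw [Finset.mem_range] at hm ⊢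
    omega
  have hy : 0 < 1 + ‖y‖ ^ 2 := by positivity
  have hr := localRadius_pos y
  have hpow : (1 + ‖y‖ ^ 2) ^ (δ + (p : ℝ)) * localRadius y ^ (2 * m)
      ≤ (1 + ‖y‖ ^ 2) ^ (δ + ((m + p : ℕ) : ℝ)) := by
    have h : localRadius y ^ 2 ≤ 1 + ‖y‖ ^ 2 := by
      rw [one_add_norm_sq_eq y]
      linarith [sq_nonneg (localRadius y)]
    rw [show δ + ((m + p : ℕ) : ℝ) = (δ + p) + m by push_cast; ring,
      Real.rpow_add hy (δ + p), Real.rpow_natCast _ m, pow_mul]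
    exact mul_le_mul_of_nonneg_left (pow_le_pow_left₀ (sq_nonneg _) h m) (by positivity)
  rw [← mul_assoc, ← ENNReal.ofReal_mul (by positivity),
    ← lintegral_const_mul' _ _ ENNReal.ofReal_ne_top,
    ← lintegral_const_mul' _ _ ENNReal.coe_ne_top]
  refine setLIntegral_mono' Metric.isClosed_closedBall.measurableSet fun x hx => ?_
  calc
    _ ≤ ENNReal.ofReal (4 ^ |δ + ((m + p : ℕ) : ℝ)| * (1 + ‖x‖ ^ 2) ^ (δ + ((m + p : ℕ) : ℝ))) *
        ‖iteratedFDeriv ℝ (m + p) f x‖ₑ ^ 2 := by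
      refine mul_le_mul' (ENNReal.ofReal_le_ofReal ?_) le_rfl
      exact hpow.trans (one_add_norm_sq_rpow_le hx _).2
    _ = ENNReal.ofReal (4 ^ |δ + ((m + p : ℕ) : ℝ)|) *
        (ENNReal.ofReal ((1 + ‖x‖ ^ 2) ^ (δ + ((m + p : ℕ) : ℝ))) *
          ‖iteratedFDeriv ℝ (m + p) f x‖ₑ ^ 2) := by
      rw [ENNReal.ofReal_mul (by positivity), mul_assoc]
    _ ≤ _ := by
      refine mul_le_mul' le_rfl ?_
      exact Finset.single_le_sum (f := fun k : ℕ => ENNReal.ofReal ((1 + ‖x‖ ^ 2) ^ (δ + (k : ℝ))) *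
        ‖iteratedFDeriv ℝ k f x‖ₑ ^ 2) (fun _ _ => zero_le) hmp

theorem rpow_mul_inv_localRadius_pow_le {n : ℕ} {e e' : ℝ} (he : e ≤ e' + n / 2)
    (y : EuclideanSpace ℝ (Fin n)) :
    (1 + ‖y‖ ^ 2) ^ e * (localRadius y ^ n)⁻¹ ≤ 2 ^ n * (1 + ‖y‖ ^ 2) ^ e' := by
  have hy : 1 ≤ 1 + ‖y‖ ^ 2 := by linarith [sq_nonneg ‖y‖]
  have hr : localRadius y ^ n = (1 + ‖y‖ ^ 2) ^ ((n : ℝ) / 2) / 2 ^ n := by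
    rw [localRadius, div_pow, Real.sqrt_eq_rpow, ← Real.rpow_natCast, ← Real.rpow_mul (by positivity)]
    congr 2
    ring
  have h := Real.rpow_le_rpow_of_exponent_le hy he
  rw [Real.rpow_add (by positivity)] at h
  rw [hr, inv_div, ← mul_div_assoc, div_le_iff₀ (by positivity)]
  nlinarith [pow_pos (two_pos (α := ℝ)) n]

theorem exists_lintegral_half_closedBall_le {n s₁ s₂ p q : ℕ} {δ δ₁ δ₂ : ℝ}
    (hp : p ≤ s₁) (hq : q ≤ s₂) (hs : n < 2 * ((s₁ - p) + (s₂ - q)))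
    (hδ : δ ≤ δ₁ + δ₂ + n / 2) :
    ∃ K : ℝ≥0, ∀ (y : EuclideanSpace ℝ (Fin n)) (f₁ f₂ : EuclideanSpace ℝ (Fin n) → ℝ),
      ContDiff ℝ (⊤ : ℕ∞) f₁ → ContDiff ℝ (⊤ : ℕ∞) f₂ →
      ∫⁻ x in Metric.closedBall y (localRadius y / 2),
          ENNReal.ofReal ((1 + ‖x‖ ^ 2) ^ (δ + ((p + q : ℕ) : ℝ))) *
            (‖iteratedFDeriv ℝ p f₁ x‖ₑ ^ 2 * ‖iteratedFDeriv ℝ q f₂ x‖ₑ ^ 2)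
        ≤ K * ((∫⁻ x in Metric.closedBall y (localRadius y), sobolevDensity s₁ δ₁ f₁ x) *
          ∫⁻ x in Metric.closedBall y (localRadius y), sobolevDensity s₂ δ₂ f₂ x) := by
  obtain ⟨K, hK⟩ := exists_lintegral_closedBall_mul_sq_le n p q (s₁ - p) (s₂ - q) hs
  obtain ⟨K₁, hK₁⟩ := exists_weight_mul_ballEnergy_le n hp δ₁
  obtain ⟨K₂, hK₂⟩ := exists_weight_mul_ballEnergy_le n hq δ₂
  set e : ℝ := δ + ((p + q : ℕ) : ℝ) with he
  refine ⟨K * Real.toNNReal (4 ^ |e| * 2 ^ n) * (K₁ * K₂), fun y f₁ f₂ hf₁ hf₂ => ?_⟩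
  have hr := localRadius_pos y
  have hw : 4 ^ |e| * (1 + ‖y‖ ^ 2) ^ e * (localRadius y ^ n)⁻¹ ≤ 4 ^ |e| * 2 ^ n *
      ((1 + ‖y‖ ^ 2) ^ (δ₁ + (p : ℝ)) * (1 + ‖y‖ ^ 2) ^ (δ₂ + (q : ℝ))) := by
    rw [mul_assoc, mul_assoc, ← Real.rpow_add (by positivity)]
    refine mul_le_mul_of_nonneg_left (rpow_mul_inv_localRadius_pow_le ?_ y) (by positivity)
    rw [he]
    push_cast
    linarith
  have hw' := ENNReal.ofReal_le_ofReal hw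
  rw [ENNReal.ofReal_mul (by positivity),
    ENNReal.ofReal_mul (p := (4 : ℝ) ^ |e| * 2 ^ n) (by positivity),
    ENNReal.ofReal_mul (p := (1 + ‖y‖ ^ 2) ^ (δ₁ + (p : ℝ))) (by positivity)] at hw'
  calc
    _ ≤ ∫⁻ x in Metric.closedBall y (localRadius y / 2),
        ENNReal.ofReal (4 ^ |e| * (1 + ‖y‖ ^ 2) ^ e) *
          (‖iteratedFDeriv ℝ p f₁ x‖ₑ ^ 2 * ‖iteratedFDeriv ℝ q f₂ x‖ₑ ^ 2) := by
      refine setLIntegral_mono' Metric.isClosed_closedBall.measurableSet fun x hx => ?_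
      gcongr
      refine (one_add_norm_sq_rpow_le ?_ _).1
      rw [Metric.mem_closedBall] at hx
      linarith
    _ ≤ ENNReal.ofReal (4 ^ |e| * (1 + ‖y‖ ^ 2) ^ e) * (K * ENNReal.ofReal (localRadius y ^ n)⁻¹ *
        (ballEnergy (s₁ - p) p (localRadius y) y f₁ *
          ballEnergy (s₂ - q) q (localRadius y) y f₂)) := by
      rw [lintegral_const_mul' _ _ ENNReal.ofReal_ne_top]
      gcongr
      exact hK _ hr y f₁ f₂ hf₁ hf₂
    _ = K * (ENNReal.ofReal (4 ^ |e| * (1 + ‖y‖ ^ 2) ^ e) *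
        ENNReal.ofReal (localRadius y ^ n)⁻¹) *
        (ballEnergy (s₁ - p) p (localRadius y) y f₁ *
          ballEnergy (s₂ - q) q (localRadius y) y f₂) := by ring
    _ ≤ K * (ENNReal.ofReal (4 ^ |e| * 2 ^ n) *
        (ENNReal.ofReal ((1 + ‖y‖ ^ 2) ^ (δ₁ + (p : ℝ))) *
          ENNReal.ofReal ((1 + ‖y‖ ^ 2) ^ (δ₂ + (q : ℝ))))) *
        (ballEnergy (s₁ - p) p (localRadius y) y f₁ *
          ballEnergy (s₂ - q) q (localRadius y) y f₂) := by gcongr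
    _ = K * ENNReal.ofReal (4 ^ |e| * 2 ^ n) *
        ((ENNReal.ofReal ((1 + ‖y‖ ^ 2) ^ (δ₁ + (p : ℝ))) *
          ballEnergy (s₁ - p) p (localRadius y) y f₁) *
        (ENNReal.ofReal ((1 + ‖y‖ ^ 2) ^ (δ₂ + (q : ℝ))) *
          ballEnergy (s₂ - q) q (localRadius y) y f₂)) := by ring
    _ ≤ K * ENNReal.ofReal (4 ^ |e| * 2 ^ n) *
        ((K₁ * ∫⁻ x in Metric.closedBall y (localRadius y), sobolevDensity s₁ δ₁ f₁ x) *
        (K₂ * ∫⁻ x in Metric.closedBall y (localRadius y), sobolevDensity s₂ δ₂ f₂ x)) := by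
      exact mul_le_mul' le_rfl (mul_le_mul' (hK₁ y f₁) (hK₂ y f₂))
    _ = _ := by
      rw [ENNReal.ofReal]
      push_cast
      ring

theorem exists_lintegral_weight_mul_sq_le {n s₁ s₂ p q : ℕ} {δ δ₁ δ₂ : ℝ}
    (hp : p ≤ s₁) (hq : q ≤ s₂) (hs : n < 2 * ((s₁ - p) + (s₂ - q)))
    (hδ : δ ≤ δ₁ + δ₂ + n / 2) :
    ∃ K : ℝ≥0, ∀ f₁ f₂ : EuclideanSpace ℝ (Fin n) → ℝ,
      ContDiff ℝ (⊤ : ℕ∞) f₁ → ContDiff ℝ (⊤ : ℕ∞) f₂ →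
      ∫⁻ x, sobolevDensity s₁ δ₁ f₁ x ≠ ⊤ →
      ∫⁻ x, ENNReal.ofReal ((1 + ‖x‖ ^ 2) ^ (δ + ((p + q : ℕ) : ℝ))) *
            (‖iteratedFDeriv ℝ p f₁ x‖ₑ ^ 2 * ‖iteratedFDeriv ℝ q f₂ x‖ₑ ^ 2)
        ≤ K * ((∫⁻ x, sobolevDensity s₁ δ₁ f₁ x) * ∫⁻ x, sobolevDensity s₂ δ₂ f₂ x) := by
  obtain ⟨K, hK⟩ := exists_lintegral_half_closedBall_le hp hq hs hδ
  obtain ⟨L, hL⟩ := exists_lintegral_le_weight_closedBall n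
  obtain ⟨U, hU⟩ := exists_lintegral_weight_closedBall_le n
  refine ⟨L * K * U, fun f₁ f₂ hf₁ hf₂ hfin => ?_⟩
  set W₁ := ∫⁻ x, sobolevDensity s₁ δ₁ f₁ x with hW₁
  calc
    _ ≤ L * ∫⁻ y, ENNReal.ofReal (localRadius y ^ n)⁻¹ *
        ∫⁻ x in Metric.closedBall y (localRadius y / 2),
          ENNReal.ofReal ((1 + ‖x‖ ^ 2) ^ (δ + ((p + q : ℕ) : ℝ))) *
            (‖iteratedFDeriv ℝ p f₁ x‖ₑ ^ 2 * ‖iteratedFDeriv ℝ q f₂ x‖ₑ ^ 2) :=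
      hL _ ((measurable_ofReal_weight _).mul
        ((measurable_enorm_iteratedFDeriv_sq hf₁ p).mul (measurable_enorm_iteratedFDeriv_sq hf₂ q)))
    _ ≤ L * ∫⁻ y, K * W₁ * (ENNReal.ofReal (localRadius y ^ n)⁻¹ *
        ∫⁻ x in Metric.closedBall y (localRadius y), sobolevDensity s₂ δ₂ f₂ x) := by
      refine mul_le_mul' le_rfl (lintegral_mono fun y => ?_)
      refine (mul_le_mul' le_rfl ((hK y f₁ f₂ hf₁ hf₂).trans (mul_le_mul' le_rfl
        (mul_le_mul' (setLIntegral_le_lintegral _ _) le_rfl)))).trans_eq ?_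
      ring
    _ ≤ L * (K * W₁ * (U * ∫⁻ x, sobolevDensity s₂ δ₂ f₂ x)) := by
      rw [lintegral_const_mul' _ _ (ENNReal.mul_ne_top ENNReal.coe_ne_top hfin)]
      gcongr
      exact hU _ (measurable_sobolevDensity hf₂)
    _ = _ := by
      push_cast
      ring

theorem enorm_iteratedFDeriv_mul_sq_le {E : Type*} [NormedAddCommGroup E] [NormedSpace ℝ E]
    {f₁ f₂ : E → ℝ} (hf₁ : ContDiff ℝ (⊤ : ℕ∞) f₁) (hf₂ : ContDiff ℝ (⊤ : ℕ∞) f₂) (k : ℕ) (x : E) :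
    ‖iteratedFDeriv ℝ k (fun y => f₁ y * f₂ y) x‖ₑ ^ 2
      ≤ ((k + 1) * 4 ^ k : ℝ≥0) * ∑ p ∈ Finset.range (k + 1),
        ‖iteratedFDeriv ℝ p f₁ x‖ₑ ^ 2 * ‖iteratedFDeriv ℝ (k - p) f₂ x‖ₑ ^ 2 := by
  have h : ‖iteratedFDeriv ℝ k (fun y => f₁ y * f₂ y) x‖ ^ 2
      ≤ ((k + 1) * 4 ^ k : ℝ≥0) * ∑ p ∈ Finset.range (k + 1),
        ‖iteratedFDeriv ℝ p f₁ x‖ ^ 2 * ‖iteratedFDeriv ℝ (k - p) f₂ x‖ ^ 2 := by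
    calc
      _ ≤ (∑ p ∈ Finset.range (k + 1), (k.choose p : ℝ) * ‖iteratedFDeriv ℝ p f₁ x‖ *
          ‖iteratedFDeriv ℝ (k - p) f₂ x‖) ^ 2 := by
        gcongr
        exact norm_iteratedFDeriv_mul_le hf₁ hf₂ x (by exact_mod_cast le_top)
      _ ≤ (k + 1 : ℕ) * ∑ p ∈ Finset.range (k + 1), ((k.choose p : ℝ) *
          ‖iteratedFDeriv ℝ p f₁ x‖ * ‖iteratedFDeriv ℝ (k - p) f₂ x‖) ^ 2 := by
        simpa using sq_sum_le_card_mul_sum_sq (s := Finset.range (k + 1))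
          (f := fun p => (k.choose p : ℝ) * ‖iteratedFDeriv ℝ p f₁ x‖ *
            ‖iteratedFDeriv ℝ (k - p) f₂ x‖)
      _ ≤ (k + 1 : ℕ) * ∑ p ∈ Finset.range (k + 1), (2 ^ k *
          ‖iteratedFDeriv ℝ p f₁ x‖ * ‖iteratedFDeriv ℝ (k - p) f₂ x‖) ^ 2 := by
        gcongr with p
        exact_mod_cast Nat.choose_le_two_pow k p
      _ = _ := by
        simp only [mul_pow, mul_assoc, ← Finset.mul_sum]
        rw [← pow_mul, mul_comm k 2, pow_mul]
        push_cast
        norm_num [mul_assoc]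
  have h' := ENNReal.ofReal_le_ofReal h
  rw [ENNReal.ofReal_mul (NNReal.coe_nonneg _), ENNReal.ofReal_coe_nnreal,
    ENNReal.ofReal_sum_of_nonneg fun _ _ => by positivity] at h'
  simpa only [ENNReal.ofReal_mul (sq_nonneg _), ENNReal.ofReal_pow (norm_nonneg _),
    ofReal_norm] using h'

theorem exists_lintegral_weight_iteratedFDeriv_mul_le {n k s₁ s₂ : ℕ} {δ δ₁ δ₂ : ℝ}
    (h₁ : k ≤ s₁) (h₂ : k ≤ s₂) (hs : (k : ℝ) < (s₁ : ℝ) + s₂ - n / 2)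
    (hδ : δ ≤ δ₁ + δ₂ + n / 2) :
    ∃ K : ℝ≥0, ∀ f₁ f₂ : EuclideanSpace ℝ (Fin n) → ℝ,
      ContDiff ℝ (⊤ : ℕ∞) f₁ → ContDiff ℝ (⊤ : ℕ∞) f₂ →
      ∫⁻ x, sobolevDensity s₁ δ₁ f₁ x ≠ ⊤ →
      ∫⁻ x, ENNReal.ofReal ((1 + ‖x‖ ^ 2) ^ (δ + (k : ℝ))) *
            ‖iteratedFDeriv ℝ k (fun y => f₁ y * f₂ y) x‖ₑ ^ 2
        ≤ K * ((∫⁻ x, sobolevDensity s₁ δ₁ f₁ x) * ∫⁻ x, sobolevDensity s₂ δ₂ f₂ x) := by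
  have hnat : 2 * k + n < 2 * (s₁ + s₂) := by
    have h : (2 * k + n : ℝ) < 2 * (s₁ + s₂) := by linarith
    exact_mod_cast h
  have hex (p : ℕ) : ∃ K : ℝ≥0, p ≤ k → ∀ f₁ f₂ : EuclideanSpace ℝ (Fin n) → ℝ,
      ContDiff ℝ (⊤ : ℕ∞) f₁ → ContDiff ℝ (⊤ : ℕ∞) f₂ →
      ∫⁻ x, sobolevDensity s₁ δ₁ f₁ x ≠ ⊤ →
      ∫⁻ x, ENNReal.ofReal ((1 + ‖x‖ ^ 2) ^ (δ + (k : ℝ))) *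
            (‖iteratedFDeriv ℝ p f₁ x‖ₑ ^ 2 * ‖iteratedFDeriv ℝ (k - p) f₂ x‖ₑ ^ 2)
        ≤ K * ((∫⁻ x, sobolevDensity s₁ δ₁ f₁ x) * ∫⁻ x, sobolevDensity s₂ δ₂ f₂ x) := by
    by_cases hp : p ≤ k
    · obtain ⟨K, hK⟩ := exists_lintegral_weight_mul_sq_le (hp.trans h₁)
        ((Nat.sub_le k p).trans h₂) (by omega) hδ
      rw [Nat.add_sub_cancel' hp] at hK
      exact ⟨K, fun _ => hK⟩
    · exact ⟨0, fun h => absurd h hp⟩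
  choose K hK using hex
  refine ⟨(k + 1) * 4 ^ k * ∑ p ∈ Finset.range (k + 1), K p, fun f₁ f₂ hf₁ hf₂ hfin => ?_⟩
  have hm (p : ℕ) : Measurable fun x : EuclideanSpace ℝ (Fin n) =>
      ENNReal.ofReal ((1 + ‖x‖ ^ 2) ^ (δ + (k : ℝ))) *
        (‖iteratedFDeriv ℝ p f₁ x‖ₑ ^ 2 * ‖iteratedFDeriv ℝ (k - p) f₂ x‖ₑ ^ 2) :=
    (measurable_ofReal_weight _).mul
      ((measurable_enorm_iteratedFDeriv_sq hf₁ p).mul (measurable_enorm_iteratedFDeriv_sq hf₂ _))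
  calc
    _ ≤ ∫⁻ x, ((k + 1) * 4 ^ k : ℝ≥0) * ∑ p ∈ Finset.range (k + 1),
        ENNReal.ofReal ((1 + ‖x‖ ^ 2) ^ (δ + (k : ℝ))) *
          (‖iteratedFDeriv ℝ p f₁ x‖ₑ ^ 2 * ‖iteratedFDeriv ℝ (k - p) f₂ x‖ₑ ^ 2) := by
      refine lintegral_mono fun x => ?_
      rw [← Finset.mul_sum, mul_left_comm]
      exact mul_le_mul' le_rfl (enorm_iteratedFDeriv_mul_sq_le hf₁ hf₂ k x)
    _ = ((k + 1) * 4 ^ k : ℝ≥0) * ∑ p ∈ Finset.range (k + 1),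
        ∫⁻ x, ENNReal.ofReal ((1 + ‖x‖ ^ 2) ^ (δ + (k : ℝ))) *
          (‖iteratedFDeriv ℝ p f₁ x‖ₑ ^ 2 * ‖iteratedFDeriv ℝ (k - p) f₂ x‖ₑ ^ 2) := by
      rw [lintegral_const_mul' _ _ ENNReal.coe_ne_top, lintegral_finsetSum _ fun p _ => hm p]
    _ ≤ ((k + 1) * 4 ^ k : ℝ≥0) * ∑ p ∈ Finset.range (k + 1), K p *
        ((∫⁻ x, sobolevDensity s₁ δ₁ f₁ x) * ∫⁻ x, sobolevDensity s₂ δ₂ f₂ x) := by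
      refine mul_le_mul' le_rfl (Finset.sum_le_sum fun p hp => ?_)
      exact hK p (Finset.mem_range_succ_iff.1 hp) f₁ f₂ hf₁ hf₂ hfin
    _ = _ := by
      rw [← Finset.sum_mul, ← mul_assoc, ← ENNReal.ofNNReal_finsetSum, ← ENNReal.coe_mul]

theorem exists_lintegral_sobolevDensity_mul_le {n s s₁ s₂ : ℕ} {δ δ₁ δ₂ : ℝ}
    (h₁ : s ≤ s₁) (h₂ : s ≤ s₂) (hs : (s : ℝ) < (s₁ : ℝ) + s₂ - n / 2)
    (hδ : δ ≤ δ₁ + δ₂ + n / 2) :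
    ∃ K : ℝ≥0, ∀ f₁ f₂ : EuclideanSpace ℝ (Fin n) → ℝ,
      ContDiff ℝ (⊤ : ℕ∞) f₁ → ContDiff ℝ (⊤ : ℕ∞) f₂ →
      ∫⁻ x, sobolevDensity s₁ δ₁ f₁ x ≠ ⊤ →
      ∫⁻ x, sobolevDensity s δ (fun y => f₁ y * f₂ y) x
        ≤ K * ((∫⁻ x, sobolevDensity s₁ δ₁ f₁ x) * ∫⁻ x, sobolevDensity s₂ δ₂ f₂ x) := by
  have hex (k : Finset.range (s + 1)) := by
    have hk : (k : ℕ) ≤ s := Finset.mem_range_succ_iff.1 k.2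
    have hk' : ((k : ℕ) : ℝ) ≤ s := by exact_mod_cast hk
    exact exists_lintegral_weight_iteratedFDeriv_mul_le (hk.trans h₁) (hk.trans h₂)
      (hk'.trans_lt hs) hδ
  choose K hK using hex
  refine ⟨∑ k, K k, fun f₁ f₂ hf₁ hf₂ hfin => ?_⟩
  have hm (k : ℕ) : Measurable fun x : EuclideanSpace ℝ (Fin n) =>
      ENNReal.ofReal ((1 + ‖x‖ ^ 2) ^ (δ + (k : ℝ))) *
        ‖iteratedFDeriv ℝ k (fun y => f₁ y * f₂ y) x‖ₑ ^ 2 :=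
    (measurable_ofReal_weight _).mul (measurable_enorm_iteratedFDeriv_sq (hf₁.mul hf₂) k)
  unfold sobolevDensity
  rw [lintegral_finsetSum _ fun k _ => hm k, ENNReal.ofNNReal_finsetSum, Finset.sum_mul,
    ← Finset.sum_coe_sort]
  exact Finset.sum_le_sum fun k _ => hK k f₁ f₂ hf₁ hf₂ hfin

/-- **Weighted Sobolev multiplication inequality on `ℝⁿ`**: if `s ≤ s₁`, `s ≤ s₂`,
`s < s₁ + s₂ − n/2` and `δ < δ₁ + δ₂ + n/2`, then there is a constant
`C = C(n, s, s₁, s₂, δ, δ₁, δ₂)` such that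
`‖f₁·f₂‖_{H_{s,δ}} ≤ C ‖f₁‖_{H_{s₁,δ₁}} ‖f₂‖_{H_{s₂,δ₂}}` for all smooth `f₁, f₂` with
finite corresponding norms. -/
theorem weighted_sobolev_multiplication
    (n s s₁ s₂ : ℕ) (hn : 1 ≤ n) (δ δ₁ δ₂ : ℝ)
    (h₁ : s ≤ s₁) (h₂ : s ≤ s₂)
    (hs : (s : ℝ) < (s₁ : ℝ) + s₂ - n / 2) (hδ : δ < δ₁ + δ₂ + n / 2) :
    ∃ C : ℝ, 0 < C ∧
      ∀ f₁ f₂ : EuclideanSpace ℝ (Fin n) → ℝ,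
        ContDiff ℝ (⊤ : ℕ∞) f₁ → ContDiff ℝ (⊤ : ℕ∞) f₂ →
        wSob n s₁ δ₁ f₁ < ⊤ → wSob n s₂ δ₂ f₂ < ⊤ →
        wSob n s δ (fun x => f₁ x * f₂ x)
          ≤ ENNReal.ofReal C * wSob n s₁ δ₁ f₁ * wSob n s₂ δ₂ f₂ := by
  obtain ⟨K, hK⟩ := exists_lintegral_sobolevDensity_mul_le h₁ h₂ hs hδ.le
  refine ⟨√K + 1, by positivity, fun f₁ f₂ hf₁ hf₂ hfin _ => ?_⟩
  rw [wSob_eq hf₁] at hfin ⊢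
  rw [wSob_eq hf₂, wSob_eq (hf₁.mul hf₂)]
  have hfin' : ∫⁻ x, sobolevDensity s₁ δ₁ f₁ x ≠ ⊤ := by
    rw [ENNReal.rpow_lt_top_iff_of_pos (by norm_num)] at hfin
    exact hfin.ne
  have hsqrt : (K : ℝ≥0∞) ^ (1 / 2 : ℝ) ≤ ENNReal.ofReal (√K + 1) := by
    rw [← ENNReal.ofReal_coe_nnreal, ENNReal.ofReal_rpow_of_nonneg (NNReal.coe_nonneg K) (by norm_num),
      ← Real.sqrt_eq_rpow]
    exact ENNReal.ofReal_le_ofReal (le_add_of_nonneg_right zero_le_one)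
  refine (ENNReal.rpow_le_rpow (hK f₁ f₂ hf₁ hf₂ hfin') (by norm_num)).trans ?_
  rw [ENNReal.mul_rpow_of_nonneg _ _ (by norm_num), ENNReal.mul_rpow_of_nonneg _ _ (by norm_num),
    ← mul_assoc]
  gcongr
end
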